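/- For every n ∈ ℕ, a Q-nonsingular quadratic harmonic morphism ℝ^M → ℝ^{n+1} exists if and only if M = 2km(n) for some k ∈ ℕ. Furthermore, if k = 1 then every such φ is domain-minimal, hence umbilical, and domain-equivalent to λφ₀ for some λ > 0 and φ₀ ∈ H₂¹(2m(n),n+1); if k ≥ 2 then every such φ is domain-equivalent to a direct sum λ₁φ₁⊕…⊕λₖφₖ with λᵢ > 0 and domain-minimal φᵢ ∈ H₂¹(2m(n),n+1). -/

import Mathlib

open Matrix BigOperators

/-- Partial derivative in the `i`-th coordinate direction. -/
noncomputable def pderiv {m : ℕ} (i : Fin m) (f : (Fin m → ℝ) → ℝ) : (Fin m → ℝ) → ℝ :=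
  fun x => fderiv ℝ f x (Pi.single i 1)

/-- A map `ℝ^m → ℝ^n` is a harmonic morphism iff each component is harmonic and
the map is horizontally weakly conformal. -/
def IsHarmonicMorphism {m n : ℕ} (φ : (Fin m → ℝ) → (Fin n → ℝ)) : Prop :=
  (∀ (α : Fin n) (x : Fin m → ℝ), ∑ i : Fin m, pderiv i (pderiv i fun y => φ y α) x = 0) ∧
  ∃ lam : (Fin m → ℝ) → ℝ, ∀ (x : Fin m → ℝ) (α β : Fin n),
      ∑ i : Fin m, pderiv i (fun y => φ y α) x * pderiv i (fun y => φ y β) x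
        = lam x ^ 2 * (if α = β then 1 else 0)

/-- `A` is the family of symmetric component matrices of the quadratic map `φ`;
the components are genuine (nonzero) quadratic forms. -/
def Represents {m n : ℕ} (A : Fin n → Matrix (Fin m) (Fin m) ℝ)
    (φ : (Fin m → ℝ) → (Fin n → ℝ)) : Prop :=
  (∀ α, (A α).IsSymm) ∧ (∀ α, A α ≠ 0) ∧ ∀ x α, φ x α = x ⬝ᵥ (A α).mulVec x

/-- A quadratic harmonic morphism. -/
def IsQuadraticHM {m n : ℕ} (φ : (Fin m → ℝ) → (Fin n → ℝ)) : Prop :=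
  (∃ A, Represents A φ) ∧ IsHarmonicMorphism φ

/-- `μ` is an eigenvalue of `A`. -/
def HasEigen {m : ℕ} (A : Matrix (Fin m) (Fin m) ℝ) (μ : ℝ) : Prop :=
  ∃ v : Fin m → ℝ, v ≠ 0 ∧ A.mulVec v = μ • v

/-- `φ` is Q-nonsingular: the common rank of the component matrices equals the
domain dimension. -/
def QNonsingular {m n : ℕ} (φ : (Fin m → ℝ) → (Fin n → ℝ)) : Prop :=
  ∃ A, Represents A φ ∧ ∀ α, (A α).rank = m

/-- `φ` is umbilical: all positive eigenvalues of the component matrices are equal. -/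
def Umbilical {m n : ℕ} (φ : (Fin m → ℝ) → (Fin n → ℝ)) : Prop :=
  ∃ A, Represents A φ ∧ ∀ (α : Fin n) (μ ν : ℝ), 0 < μ → 0 < ν →
    HasEigen (A α) μ → HasEigen (A α) ν → μ = ν

/-- `φ ∈ H₂¹(m,n)`: umbilical quadratic harmonic morphism with positive eigenvalue 1. -/
def MemH21 {m n : ℕ} (φ : (Fin m → ℝ) → (Fin n → ℝ)) : Prop :=
  IsQuadraticHM φ ∧ ∃ A, Represents A φ ∧
    ∀ α : Fin n, HasEigen (A α) 1 ∧ ∀ μ : ℝ, 0 < μ → HasEigen (A α) μ → μ = 1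

/-- `G` is an orthogonal matrix. -/
def IsOrthoMat {m : ℕ} (G : Matrix (Fin m) (Fin m) ℝ) : Prop := Gᵀ * G = 1

/-- Domain-equivalence: `φ = ψ ∘ G` for an orthogonal `G`. -/
def DomainEquiv {m n : ℕ} (φ ψ : (Fin m → ℝ) → (Fin n → ℝ)) : Prop :=
  ∃ G : Matrix (Fin m) (Fin m) ℝ, IsOrthoMat G ∧ ∀ x, φ x = ψ (G.mulVec x)

/-- Bi-equivalence: `φ = H⁻¹ ∘ ψ ∘ G` for orthogonal `G`, `H`. -/
def BiEquiv {m n : ℕ} (φ ψ : (Fin m → ℝ) → (Fin n → ℝ)) : Prop :=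
  ∃ (G : Matrix (Fin m) (Fin m) ℝ) (H : Matrix (Fin n) (Fin n) ℝ),
    IsOrthoMat G ∧ IsOrthoMat H ∧ ∀ x, φ x = H⁻¹.mulVec (ψ (G.mulVec x))

/-- A Clifford system: symmetric endomorphisms with `PᵢPⱼ + PⱼPᵢ = 2δᵢⱼ Id`. -/
def IsCliffordSystem {N n : ℕ} (P : Fin n → Matrix (Fin N) (Fin N) ℝ) : Prop :=
  (∀ i, (P i).IsSymm) ∧
  ∀ i j, P i * P j + P j * P i =
    if i = j then (2 : ℝ) • (1 : Matrix (Fin N) (Fin N) ℝ) else 0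

/-- The map `F` sending a Clifford system to the quadratic map
`X ↦ (⟨P₁X,X⟩,…,⟨PₙX,X⟩)`. -/
def cliffordMap {N n : ℕ} (P : Fin n → Matrix (Fin N) (Fin N) ℝ) :
    (Fin N → ℝ) → Fin n → ℝ := fun X α => X ⬝ᵥ (P α).mulVec X

/-- Algebraic equivalence of Clifford systems. -/
def CliffordAlgEquiv {N n : ℕ} (P Q : Fin n → Matrix (Fin N) (Fin N) ℝ) : Prop :=
  ∃ A : Matrix (Fin N) (Fin N) ℝ, IsOrthoMat A ∧ ∀ i, Q i = A * P i * Aᵀ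

/-- Irreducibility: the space is not a direct sum of two nontrivial invariant subspaces. -/
def CliffordIrreducible {N n : ℕ} (P : Fin n → Matrix (Fin N) (Fin N) ℝ) : Prop :=
  ¬∃ U V : Submodule ℝ (Fin N → ℝ), U ≠ ⊥ ∧ V ≠ ⊥ ∧ IsCompl U V ∧
    (∀ i, ∀ x ∈ U, (P i).mulVec x ∈ U) ∧ ∀ i, ∀ x ∈ V, (P i).mulVec x ∈ V

/-- An O-system: orthogonal endomorphisms with `τᵢᵗτⱼ + τⱼᵗτᵢ = 2δᵢⱼ Id`. -/
def IsOSystem {m n : ℕ} (τ : Fin n → Matrix (Fin m) (Fin m) ℝ) : Prop :=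
  (∀ i, (τ i)ᵀ * τ i = 1) ∧
  ∀ i j, (τ i)ᵀ * τ j + (τ j)ᵀ * τ i =
    if i = j then (2 : ℝ) • (1 : Matrix (Fin m) (Fin m) ℝ) else 0

/-- Algebraic equivalence of O-systems. -/
def OAlgEquiv {m n : ℕ} (τ ρ : Fin n → Matrix (Fin m) (Fin m) ℝ) : Prop :=
  ∃ θ : Matrix (Fin m) (Fin m) ℝ, IsOrthoMat θ ∧ ∀ i, ρ i = θ * τ i * θᵀ

/-- Block-diagonal direct sum of square matrices. -/
def bdiag {m l : ℕ} (A : Matrix (Fin m) (Fin m) ℝ) (B : Matrix (Fin l) (Fin l) ℝ) :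
    Matrix (Fin (m + l)) (Fin (m + l)) ℝ :=
  (Matrix.fromBlocks A 0 0 B).submatrix finSumFinEquiv.symm finSumFinEquiv.symm

/-- The block matrix `[[I,0],[0,-I]]`. -/
def assocP0 (m : ℕ) : Matrix (Fin (m + m)) (Fin (m + m)) ℝ :=
  (Matrix.fromBlocks 1 0 0 (-1)).submatrix finSumFinEquiv.symm finSumFinEquiv.symm

/-- The block matrix `[[0,τ],[τᵗ,0]]`. -/
def assocPi {m : ℕ} (τ : Matrix (Fin m) (Fin m) ℝ) : Matrix (Fin (m + m)) (Fin (m + m)) ℝ :=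
  (Matrix.fromBlocks 0 τ τᵀ 0).submatrix finSumFinEquiv.symm finSumFinEquiv.symm

/-- The Clifford system `(P₀,P₁,…,Pₙ)` associated to an O-system `(τ₁,…,τₙ)`. -/
def assocClifford {m n : ℕ} (τ : Fin n → Matrix (Fin m) (Fin m) ℝ) :
    Fin (n + 1) → Matrix (Fin (m + m)) (Fin (m + m)) ℝ :=
  Fin.cons (assocP0 m) fun j => assocPi (τ j)

/-- Direct sum of two maps: `(φ ⊕ ψ)(x,y) = φ(x) + ψ(y)`. -/
def dsum {m l n : ℕ} (φ : (Fin m → ℝ) → Fin n → ℝ) (ψ : (Fin l → ℝ) → Fin n → ℝ) :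
    (Fin (m + l) → ℝ) → Fin n → ℝ :=
  fun x => φ (fun i => x (Fin.castAdd l i)) + ψ fun j => x (Fin.natAdd m j)

/-- Transport a map along an equality of domain dimensions. -/
def reMap {a b n : ℕ} (h : a = b) (ψ : (Fin b → ℝ) → Fin n → ℝ) :
    (Fin a → ℝ) → Fin n → ℝ := fun x => ψ fun i => x (finCongr h.symm i)

/-- A separable quadratic harmonic morphism. -/
def Separable {M n : ℕ} (φ : (Fin M → ℝ) → Fin n → ℝ) : Prop :=
  ∃ (m l : ℕ) (h : M = m + l), 0 < m ∧ 0 < l ∧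
    ∃ (φ₁ : (Fin m → ℝ) → Fin n → ℝ) (φ₂ : (Fin l → ℝ) → Fin n → ℝ),
      IsQuadraticHM φ₁ ∧ IsQuadraticHM φ₂ ∧ φ = reMap h (dsum φ₁ φ₂)

/-- The `k`-fold direct sum `ψ₁ ⊕ … ⊕ ψₖ` of maps with the same domain dimension. -/
def bigDSum {k M n : ℕ} (ψ : Fin k → (Fin M → ℝ) → Fin n → ℝ) :
    (Fin (k * M) → ℝ) → Fin n → ℝ :=
  fun x => ∑ j : Fin k, ψ j fun i => x (finProdFinEquiv (j, i))

/-- Domain-minimality: no quadratic harmonic morphism into `ℝ^n` exists from a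
smaller-dimensional domain. -/
def DomainMinimal {M n : ℕ} (φ : (Fin M → ℝ) → Fin n → ℝ) : Prop :=
  IsQuadraticHM φ ∧ ∀ M' : ℕ, M' < M → ¬∃ ψ : (Fin M' → ℝ) → Fin n → ℝ, IsQuadraticHM ψ

/-- `m(n)`: dimensions of irreducible Clifford systems;
`m(1)=1, m(2)=2, m(3)=m(4)=4, m(5)=…=m(8)=8, m(n+8)=16m(n)`. -/
def mfun : ℕ → ℕ
  | 0 => 1
  | 1 => 1
  | 2 => 2
  | 3 => 4
  | 4 => 4
  | 5 => 8
  | 6 => 8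
  | 7 => 8
  | 8 => 8
  | n + 9 => 16 * mfun (n + 1)

/-- The Hurwitz–Radon number: for `m = (2r+1)·2^(c+4d)` with `0 ≤ c ≤ 3`,
`σ(m) = 2^c + 8d`. -/
def hrSigma (m : ℕ) : ℕ := 2 ^ (padicValNat 2 m % 4) + 8 * (padicValNat 2 m / 4)

/-- Pairwise anticommuting ring elements, those of `P` squaring to `1` and those of `Q` to `-1`. -/
structure IsClifford {R : Type*} [Ring R] (P Q : List R) : Prop where
  sq_pos : ∀ x ∈ P, x * x = 1
  sq_neg : ∀ x ∈ Q, x * x = -1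
  anti : (P ++ Q).Pairwise fun x y => x * y = -(y * x)

theorem anticomm_symm {R : Type*} [Ring R] {x y : R} (h : x * y = -(y * x)) :
    y * x = -(x * y) := by rw [h, neg_neg]

theorem anticomm_assoc {R : Type*} [Ring R] {x y : R} (h : x * y = -(y * x)) (z : R) :
    x * (y * z) = -(y * (x * z)) := by rw [← mul_assoc, ← mul_assoc, h, neg_mul]

theorem pairwise_anticomm_perm {R : Type*} [Ring R] {L L' : List R} (h : L.Perm L') :
    L.Pairwise (fun x y => x * y = -(y * x)) ↔ L'.Pairwise fun x y => x * y = -(y * x) :=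
  h.pairwise_iff anticomm_symm

set_option linter.unusedSimpArgs false in
/-- Multiplying four anticommuting generators by their product flips the sign of their squares
and keeps all anticommutation relations. -/
theorem quad_twist {R : Type*} [Ring R] {L : List R} {a b c e ε : R} (hε : ε = 1 ∨ ε = -1)
    (hsq : ∀ x ∈ [a, b, c, e], x * x = ε)
    (h : (a :: b :: c :: e :: L).Pairwise fun x y => x * y = -(y * x)) :
    (∀ x ∈ [a, b, c, e], a * b * c * e * x * (a * b * c * e * x) = -ε) ∧
      (a * b * c * e * a :: a * b * c * e * b :: a * b * c * e * c ::
        a * b * c * e * e :: L).Pairwise fun x y => x * y = -(y * x) := by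
  simp only [List.pairwise_cons, List.mem_cons, forall_eq_or_imp, List.not_mem_nil, false_imp_iff,
    implies_true, and_true] at h hsq ⊢
  obtain ⟨haa, hbb, hcc, hee⟩ := hsq
  obtain ⟨⟨hab, hac, hae, haL⟩, ⟨hbc, hbe, hbL⟩, ⟨hce, hcL⟩, heL, hL⟩ := h
  have ab := anticomm_symm hab
  have ac := anticomm_symm hac
  have ae := anticomm_symm hae
  have bc := anticomm_symm hbc
  have be := anticomm_symm hbe
  have ce := anticomm_symm hce
  have ab' := anticomm_assoc ab
  have ac' := anticomm_assoc ac
  have ae' := anticomm_assoc ae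
  have bc' := anticomm_assoc bc
  have be' := anticomm_assoc be
  have ce' := anticomm_assoc ce
  have sq : ∀ x : R, x * x = ε → ∀ z, x * (x * z) = ε * z := fun x hx z => by
    rw [← mul_assoc, hx]
  have aa' := sq a haa
  have bb' := sq b hbb
  have cc' := sq c hcc
  have ee' := sq e hee
  have main : ∀ x y : R, a * x = -(x * a) → b * x = -(x * b) → c * x = -(x * c) →
      e * x = -(x * e) → y * x = -(x * y) →
      a * b * c * e * y * x = -(x * (a * b * c * e * y)) := by
    intro x y xa xb xc xe xy
    simp only [mul_assoc, anticomm_assoc (anticomm_symm xa), anticomm_assoc (anticomm_symm xb),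
      anticomm_assoc (anticomm_symm xc), anticomm_assoc (anticomm_symm xe), xy, mul_neg, neg_neg]
  refine ⟨⟨?_, ?_, ?_, ?_⟩, ⟨?_, ?_, ?_, ?_⟩, ⟨?_, ?_, ?_⟩, ⟨?_, ?_⟩, ?_, hL⟩
  all_goals first
    | exact fun x hx => main x _ (haL x hx) (hbL x hx) (hcL x hx) (heL x hx)
        (by first | exact haL x hx | exact hbL x hx | exact hcL x hx | exact heL x hx)
    | (rcases hε with rfl | rfl <;>
      simp only [mul_assoc, ab, ab', ac, ac', ae, ae', bc, bc', be, be', ce, ce', haa, hbb, hcc,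
        hee, aa', bb', cc', ee', mul_neg, neg_mul, neg_neg, mul_one, one_mul])

theorem IsClifford.quad_neg_to_pos {R : Type*} [Ring R] {P Q : List R} {a b c e : R}
    (h : IsClifford P (a :: b :: c :: e :: Q)) :
    IsClifford (a * b * c * e * a :: a * b * c * e * b :: a * b * c * e * c ::
      a * b * c * e * e :: P) Q := by
  have hperm : (P ++ a :: b :: c :: e :: Q).Perm (a :: b :: c :: e :: (P ++ Q)) := by
    simpa using List.perm_append_comm_assoc P [a, b, c, e] Q
  obtain ⟨h1, h2⟩ := quad_twist (L := P ++ Q) (ε := -1) (Or.inr rfl)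
    (fun x hx => h.sq_neg x (List.mem_append_left Q hx)) ((pairwise_anticomm_perm hperm).1 h.anti)
  refine ⟨?_, fun x hx => h.sq_neg x (by simp [hx]), h2⟩
  simp only [List.mem_cons, forall_eq_or_imp, List.not_mem_nil, false_imp_iff, implies_true,
    and_true, neg_neg] at h1 ⊢
  exact ⟨h1.1, h1.2.1, h1.2.2.1, h1.2.2.2, h.sq_pos⟩

theorem IsClifford.quad_pos_to_neg {R : Type*} [Ring R] {P Q : List R} {a b c e : R}
    (h : IsClifford (a :: b :: c :: e :: P) Q) :
    IsClifford P (a * b * c * e * a :: a * b * c * e * b :: a * b * c * e * c ::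
      a * b * c * e * e :: Q) := by
  obtain ⟨h1, h2⟩ := quad_twist (L := P ++ Q) (ε := 1) (Or.inl rfl)
    (fun x hx => h.sq_pos x (List.mem_append_left P hx)) h.anti
  refine ⟨fun x hx => h.sq_pos x (by simp [hx]), ?_, (pairwise_anticomm_perm ?_).1 h2⟩
  · simp only [List.mem_cons, forall_eq_or_imp, List.not_mem_nil, false_imp_iff, implies_true,
      and_true] at h1 ⊢
    exact ⟨h1.1, h1.2.1, h1.2.2.1, h1.2.2.2, h.sq_neg⟩
  · simpa using (List.perm_append_comm_assoc P [_, _, _, _] Q).symm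

/-- Every nonzero Clifford module of signature `(p, q)` contains a submodule of dimension `d`. -/
def CliffordSubdim (p q d : ℕ) : Prop :=
  ∀ (V : Type) [AddCommGroup V] [Module ℝ V] [FiniteDimensional ℝ V] [Nontrivial V]
    (P Q : List (Module.End ℝ V)), P.length = p → Q.length = q → IsClifford P Q →
    ∃ U : Submodule ℝ V, Module.finrank ℝ U = d ∧ ∀ x ∈ P ++ Q, ∀ u ∈ U, x u ∈ U

set_option linter.unusedSimpArgs false in
theorem quad_prod {R : Type*} [Ring R] {L : List R} {a b c e : R}
    (hsq : ∀ x ∈ a :: b :: c :: e :: L, x * x = -1)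
    (h : (a :: b :: c :: e :: L).Pairwise fun x y => x * y = -(y * x)) :
    a * b * c * e * (a * b * c * e) = 1 ∧
      a * b * c * e = a * b * c * e * a * (a * b * c * e * b) * (a * b * c * e * c) *
        (a * b * c * e * e) := by
  simp only [List.pairwise_cons, List.mem_cons, forall_eq_or_imp] at hsq h
  obtain ⟨haa, hbb, hcc, hee, -⟩ := hsq
  obtain ⟨⟨hab, hac, hae, -⟩, ⟨hbc, hbe, -⟩, ⟨hce, -⟩, -⟩ := h
  have ab := anticomm_symm hab
  have ac := anticomm_symm hac
  have ae := anticomm_symm hae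
  have bc := anticomm_symm hbc
  have be := anticomm_symm hbe
  have ce := anticomm_symm hce
  have sq : ∀ x : R, x * x = -1 → ∀ z, x * (x * z) = -z := fun x hx z => by
    rw [← mul_assoc, hx, neg_one_mul]
  constructor <;>
  simp only [mul_assoc, ab, anticomm_assoc ab, ac, anticomm_assoc ac, ae,
    anticomm_assoc ae, bc, anticomm_assoc bc, be, anticomm_assoc be, ce, anticomm_assoc ce,
    haa, hbb, hcc, hee, sq a haa, sq b hbb, sq c hcc, sq e hee, mul_neg, neg_mul, neg_neg,
    mul_one, one_mul]

theorem CliffordSubdim.quad {p q d : ℕ} (h : CliffordSubdim (p + 4) q d) :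
    CliffordSubdim p (q + 4) d := by
  intro V _ _ _ _ P Q hP hQ hPQ
  obtain ⟨a, b, c, e, Q, rfl⟩ : ∃ a b c e Q', Q = a :: b :: c :: e :: Q' := by
    match Q, hQ with
    | a :: b :: c :: e :: Q', _ => exact ⟨a, b, c, e, Q', rfl⟩
  obtain ⟨U, hU, hinv⟩ := h V _ Q (by simpa using hP) (by simpa using hQ) hPQ.quad_neg_to_pos
  refine ⟨U, hU, ?_⟩
  obtain ⟨hgg, hprod⟩ := quad_prod hPQ.sq_neg (List.pairwise_append.1 hPQ.anti).2.1
  simp only [List.mem_append, List.mem_cons, or_imp, forall_and, forall_eq] at hinv ⊢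
  obtain ⟨⟨ha, hb, hc, he, hP'⟩, hQ'⟩ := hinv
  set g := a * b * c * e
  have hgU : ∀ u ∈ U, g u ∈ U := by
    intro u hu
    rw [hprod]
    exact ha _ (hb _ (hc _ (he _ hu)))
  have hback : ∀ x : Module.End ℝ V, (∀ u ∈ U, (g * x) u ∈ U) → ∀ u ∈ U, x u ∈ U := by
    intro x hx u hu
    have : x u = g ((g * x) u) := by
      rw [← Module.End.mul_apply, ← mul_assoc, hgg, one_mul]
    rw [this]
    exact hgU _ (hx u hu)
  exact ⟨hP', hback a ha, hback b hb, hback c hc, hback e he, hQ'⟩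

open Classical in
/-- The restriction of an endomorphism to a subspace it preserves, and `0` otherwise. -/
noncomputable def restrictEnd {V : Type*} [AddCommGroup V] [Module ℝ V] (W : Submodule ℝ V)
    (x : Module.End ℝ V) : Module.End ℝ W :=
  if h : ∀ w ∈ W, x w ∈ W then x.restrict h else 0

theorem restrictEnd_apply {V : Type*} [AddCommGroup V] [Module ℝ V] {W : Submodule ℝ V}
    {x : Module.End ℝ V} (h : ∀ w ∈ W, x w ∈ W) (w : W) : (restrictEnd W x w : V) = x w := by
  simp [restrictEnd, dif_pos h]

theorem CliffordSubdim.exists_le {p q d : ℕ} (h : CliffordSubdim p q d) {V : Type}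
    [AddCommGroup V] [Module ℝ V] [FiniteDimensional ℝ V] {W : Submodule ℝ V} (hW : W ≠ ⊥)
    {P Q : List (Module.End ℝ V)} (hP : P.length = p) (hQ : Q.length = q)
    (hinv : ∀ x ∈ P ++ Q, ∀ w ∈ W, x w ∈ W)
    (hpos : ∀ x ∈ P, ∀ w ∈ W, x (x w) = w) (hneg : ∀ x ∈ Q, ∀ w ∈ W, x (x w) = -w)
    (hanti : (P ++ Q).Pairwise fun x y => ∀ w ∈ W, x (y w) = -(y (x w))) :
    ∃ U ≤ W, Module.finrank ℝ U = d ∧ ∀ x ∈ P ++ Q, ∀ u ∈ U, x u ∈ U := by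
  have : Nontrivial W := Submodule.nontrivial_iff_ne_bot.2 hW
  obtain ⟨U, hU, hUinv⟩ := h W (P.map (restrictEnd W)) (Q.map (restrictEnd W)) (by simpa) (by simpa)
    { sq_pos := by
        simp only [List.mem_map, forall_exists_index, and_imp, forall_apply_eq_imp_iff₂]
        intro x hx
        ext w
        have hx' := hinv x (List.mem_append_left Q hx)
        simp [restrictEnd_apply hx', hpos x hx w w.2]
      sq_neg := by
        simp only [List.mem_map, forall_exists_index, and_imp, forall_apply_eq_imp_iff₂]
        intro x hx
        ext w
        have hx' := hinv x (List.mem_append_right P hx)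
        simp [restrictEnd_apply hx', hneg x hx w w.2]
      anti := by
        rw [← List.map_append, List.pairwise_map]
        refine hanti.imp_of_mem fun {x y} hx hy hxy => ?_
        ext w
        simp [restrictEnd_apply (hinv x hx), restrictEnd_apply (hinv y hy), hxy w w.2] }
  refine ⟨U.map W.subtype, Submodule.map_subtype_le W U, ?_, ?_⟩
  · rw [← hU]
    exact (Submodule.equivMapOfInjective _ W.subtype_injective U).finrank_eq.symm
  · rintro x hx _ ⟨u, hu, rfl⟩
    rw [← List.map_append] at hUinv
    exact ⟨_, hUinv _ (List.mem_map_of_mem hx) u hu, restrictEnd_apply (hinv x hx) u⟩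

/-- Doubling: an involution `g` anticommuting with an involution `k` splits the space into
two halves exchanged by `k`. -/
theorem CliffordSubdim.double {p q d : ℕ} (h : CliffordSubdim p q d) {V : Type} [AddCommGroup V]
    [Module ℝ V] [FiniteDimensional ℝ V] [Nontrivial V] {g k : Module.End ℝ V}
    (hg : g * g = 1) (hk : k * k = 1) (hgk : g * k = -(k * g)) {P Q : List (Module.End ℝ V)}
    (hP : P.length = p) (hQ : Q.length = q) (hPQ : IsClifford P Q)
    (hcomm : ∀ x ∈ P ++ Q, g * x = x * g) :
    ∃ U : Submodule ℝ V, (∀ u ∈ U, g u = u) ∧ (∀ x ∈ P ++ Q, ∀ u ∈ U, x u ∈ U) ∧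
      Module.finrank ℝ (U ⊔ U.map k : Submodule ℝ V) = 2 * d := by
  have hgg : ∀ v, g (g v) = v := fun v => LinearMap.congr_fun hg v
  have hkk : ∀ v, k (k v) = v := fun v => LinearMap.congr_fun hk v
  have hgk' : ∀ v, g (k v) = -k (g v) := fun v => LinearMap.congr_fun hgk v
  set W : Submodule ℝ V := LinearMap.eqLocus g 1 with hWdef
  have hmem : ∀ w, w ∈ W ↔ g w = w := fun w => Iff.rfl
  have hW : W ≠ ⊥ := by
    intro hbot
    have hz : ∀ w, g w = w → w = 0 := fun w hw => by
      have : w ∈ W := hw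
      simpa [hbot] using this
    have hneg : ∀ w, g w = -w := fun w => by
      have := hz (w + g w) (by rw [map_add, hgg, add_comm])
      exact eq_neg_of_add_eq_zero_right this
    obtain ⟨v, hv⟩ := exists_ne (0 : V)
    have h0 : k v = 0 := hz _ (by rw [hgk', hneg, map_neg, neg_neg])
    exact hv (by rw [← hkk v, h0, map_zero])
  obtain ⟨U, hUW, hU, hinv⟩ := h.exists_le hW hP hQ
    (fun x hx w hw => by
      have := LinearMap.congr_fun (hcomm x hx) w
      rw [Module.End.mul_apply, Module.End.mul_apply, (hmem w).1 hw] at this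
      exact this)
    (fun x hx w _ => LinearMap.congr_fun (hPQ.sq_pos x hx) w)
    (fun x hx w _ => LinearMap.congr_fun (hPQ.sq_neg x hx) w)
    (hPQ.anti.imp fun hxy w _ => LinearMap.congr_fun hxy w)
  refine ⟨U, fun u hu => hUW hu, hinv, ?_⟩
  have hinj : Function.Injective k := fun x y hxy => by rw [← hkk x, hxy, hkk]
  have hdisj : U ⊓ U.map k = ⊥ := by
    rw [Submodule.eq_bot_iff]
    rintro _ ⟨hx, u, hu, rfl⟩
    have h1 : g (k u) = k u := hUW hx
    have h2 : g u = u := hUW hu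
    rw [hgk', h2] at h1
    have h3 : (2 : ℝ) • k u = 0 := by
      rw [two_smul]
      nth_rw 1 [← h1]
      exact neg_add_cancel _
    simpa using h3
  have := Submodule.finrank_sup_add_finrank_inf_eq U (U.map k)
  rw [hdisj, finrank_bot, ← (Submodule.equivMapOfInjective k hinj U).finrank_eq, hU] at this
  omega

theorem map_sup_map_le {V : Type*} [AddCommGroup V] [Module ℝ V] {U : Submodule ℝ V}
    {k x : Module.End ℝ V} (h1 : ∀ u ∈ U, x u ∈ U ⊔ U.map k)
    (h2 : ∀ u ∈ U, x (k u) ∈ U ⊔ U.map k) : ∀ u ∈ U ⊔ U.map k, x u ∈ U ⊔ U.map k := by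
  have : U ⊔ U.map k ≤ (U ⊔ U.map k).comap x :=
    sup_le h1 (Submodule.map_le_iff_le_comap.2 h2)
  exact fun u hu => this hu

theorem CliffordSubdim.succ_succ {p q d : ℕ} (h : CliffordSubdim p q d) :
    CliffordSubdim (p + 1) (q + 1) (2 * d) := by
  intro V _ _ _ _ P Q hP hQ hPQ
  obtain ⟨a, P, rfl⟩ := List.exists_cons_of_length_eq_add_one hP
  obtain ⟨b, Q, rfl⟩ := List.exists_cons_of_length_eq_add_one hQ
  have hperm : (a :: P ++ b :: Q).Perm (a :: b :: (P ++ Q)) := by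
    simp
  have hanti := (pairwise_anticomm_perm hperm).1 hPQ.anti
  simp only [List.pairwise_cons, List.mem_cons, forall_eq_or_imp] at hanti
  obtain ⟨⟨hab, haL⟩, hbL, hL⟩ := hanti
  have haa := hPQ.sq_pos a (by simp)
  have hbb := hPQ.sq_neg b (by simp)
  obtain ⟨U, hgU, hinv, hU⟩ := h.double (g := a * b) (k := a) (P := P) (Q := Q)
    (by rw [mul_assoc, ← mul_assoc b, anticomm_symm hab, neg_mul, mul_assoc, hbb, mul_neg,
      mul_neg, mul_neg, mul_one, neg_neg, haa])
    haa (by rw [mul_assoc, anticomm_symm hab, mul_neg])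
    (by simpa using hP) (by simpa using hQ)
    ⟨fun x hx => hPQ.sq_pos x (by simp [hx]), fun x hx => hPQ.sq_neg x (by simp [hx]), hL⟩
    (fun x hx => by
      rw [mul_assoc, hbL x hx, mul_neg, ← mul_assoc, haL x hx, neg_mul, neg_neg, mul_assoc])
  have haa' : ∀ v, a (a v) = v := fun v => LinearMap.congr_fun haa v
  have hba' : ∀ v, b (a v) = -a (b v) := fun v => LinearMap.congr_fun (anticomm_symm hab) v
  have hbU : ∀ u ∈ U, b u = a u := fun u hu => by
    rw [← haa' (b u)]
    exact congrArg a (hgU u hu)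
  have hl : ∀ u ∈ U, u ∈ U ⊔ U.map a := fun u hu => Submodule.mem_sup_left hu
  have hr : ∀ u ∈ U, a u ∈ U ⊔ U.map a := fun u hu =>
    Submodule.mem_sup_right (Submodule.mem_map_of_mem hu)
  refine ⟨U ⊔ U.map a, hU, fun x hx => ?_⟩
  replace hx := hperm.mem_iff.1 hx
  simp only [List.mem_cons] at hx
  rcases hx with rfl | rfl | hx
  · exact map_sup_map_le hr fun u hu => by rw [haa']; exact hl u hu
  · refine map_sup_map_le (fun u hu => by rw [hbU u hu]; exact hr u hu) fun u hu => ?_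
    rw [hba', hbU u hu, haa']
    exact neg_mem (hl u hu)
  · refine map_sup_map_le (fun u hu => hl _ (hinv x hx u hu)) fun u hu => ?_
    have : x (a u) = -a (x u) := LinearMap.congr_fun (anticomm_symm (haL x hx)) u
    rw [this]
    exact neg_mem (hr _ (hinv x hx u hu))

theorem CliffordSubdim.add_two {q d : ℕ} (h : CliffordSubdim 0 q d) :
    CliffordSubdim (q + 2) 0 (2 * d) := by
  intro V _ _ _ _ P Q hP hQ hPQ
  obtain ⟨a, P, rfl⟩ := List.exists_cons_of_length_eq_add_one hP
  obtain ⟨b, P, rfl⟩ := List.exists_cons_of_length_eq_add_one (l := P) (n := q)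
    (by simpa using hP)
  obtain rfl := List.length_eq_zero_iff.1 hQ
  have hanti := hPQ.anti
  simp only [List.append_nil, List.pairwise_cons, List.mem_cons, forall_eq_or_imp] at hanti
  obtain ⟨⟨hab, haL⟩, hbL, hL⟩ := hanti
  have haa := hPQ.sq_pos a (by simp)
  have hbb := hPQ.sq_pos b (by simp)
  obtain ⟨U, hgU, hinv, hU⟩ := h.double (g := a) (k := b) (P := []) (Q := P.map (b * ·))
    haa hbb hab rfl (by simpa using hP)
    { sq_pos := by simp
      sq_neg := by
        simp only [List.mem_map, forall_exists_index, and_imp, forall_apply_eq_imp_iff₂]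
        intro x hx
        rw [mul_assoc, ← mul_assoc x, anticomm_symm (hbL x hx), neg_mul, mul_assoc,
          hPQ.sq_pos x (by simp [hx]), mul_neg, mul_one, hbb]
      anti := by
        rw [List.nil_append, List.pairwise_map]
        refine hL.imp_of_mem fun {x y} hx hy hxy => ?_
        rw [mul_assoc, ← mul_assoc x, anticomm_symm (hbL x hx), mul_assoc, ← mul_assoc y,
          anticomm_symm (hbL y hy), neg_mul, neg_mul, mul_assoc, mul_assoc, hxy]
        simp }
    (by
      simp only [List.nil_append, List.mem_map, forall_exists_index, and_imp,
        forall_apply_eq_imp_iff₂]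
      intro x hx
      rw [← mul_assoc, hab, neg_mul, mul_assoc, haL x hx, mul_neg, neg_neg, mul_assoc])
  have hbb' : ∀ v, b (b v) = v := fun v => LinearMap.congr_fun hbb v
  have hab' : ∀ v, a (b v) = -b (a v) := fun v => LinearMap.congr_fun hab v
  have hl : ∀ u ∈ U, u ∈ U ⊔ U.map b := fun u hu => Submodule.mem_sup_left hu
  have hr : ∀ u ∈ U, b u ∈ U ⊔ U.map b := fun u hu =>
    Submodule.mem_sup_right (Submodule.mem_map_of_mem hu)
  simp only [List.nil_append, List.mem_map, forall_exists_index, and_imp,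
    forall_apply_eq_imp_iff₂, Module.End.mul_apply] at hinv
  refine ⟨U ⊔ U.map b, hU, fun x hx => ?_⟩
  simp only [List.append_nil, List.mem_cons] at hx
  rcases hx with rfl | rfl | hx
  · refine map_sup_map_le (fun u hu => by rw [hgU u hu]; exact hl u hu) fun u hu => ?_
    rw [hab', hgU u hu]
    exact neg_mem (hr u hu)
  · exact map_sup_map_le hr fun u hu => by rw [hbb']; exact hl u hu
  · refine map_sup_map_le (fun u hu => ?_) fun u hu => ?_
    · rw [← hbb' (x u)]
      exact hr _ (hinv x hx u hu)
    · have : x (b u) = -b (x u) := LinearMap.congr_fun (anticomm_symm (hbL x hx)) u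
      rw [this]
      exact neg_mem (hl _ (hinv x hx u hu))

theorem CliffordSubdim.zero_zero : CliffordSubdim 0 0 1 := by
  intro V _ _ _ _ P Q hP hQ _
  obtain rfl := List.length_eq_zero_iff.1 hP
  obtain rfl := List.length_eq_zero_iff.1 hQ
  obtain ⟨v, hv⟩ := exists_ne (0 : V)
  exact ⟨ℝ ∙ v, finrank_span_singleton hv, by simp⟩

theorem exists_involution_eigenvector {V : Type*} [AddCommGroup V] [Module ℝ V] [Nontrivial V]
    {a : Module.End ℝ V} (ha : a * a = 1) : ∃ v ≠ 0, a v = v ∨ a v = -v := by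
  obtain ⟨v, hv⟩ := exists_ne (0 : V)
  have haa : a (a v) = v := LinearMap.congr_fun ha v
  by_cases h : v + a v = 0
  · exact ⟨v, hv, Or.inr (eq_neg_of_add_eq_zero_right h)⟩
  · exact ⟨_, h, Or.inl (by rw [map_add, haa, add_comm])⟩

theorem CliffordSubdim.one_zero : CliffordSubdim 1 0 1 := by
  intro V _ _ _ _ P Q hP hQ hPQ
  obtain ⟨a, rfl⟩ := List.length_eq_one_iff.1 hP
  obtain rfl := List.length_eq_zero_iff.1 hQ
  obtain ⟨v, hv, hav⟩ := exists_involution_eigenvector (hPQ.sq_pos a (by simp))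
  refine ⟨ℝ ∙ v, finrank_span_singleton hv, ?_⟩
  simp only [List.append_nil, List.mem_singleton, forall_eq]
  intro u hu
  obtain ⟨r, rfl⟩ := Submodule.mem_span_singleton.1 hu
  rw [map_smul]
  refine Submodule.smul_mem _ _ ?_
  rcases hav with h | h <;> rw [h]
  · exact Submodule.mem_span_singleton_self v
  · exact neg_mem (Submodule.mem_span_singleton_self v)

theorem mem_span_range_of_forall {V ι : Type*} [AddCommGroup V] [Module ℝ V] {f : ι → V}
    {x : Module.End ℝ V} (h : ∀ i, x (f i) ∈ Submodule.span ℝ (Set.range f)) :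
    ∀ u ∈ Submodule.span ℝ (Set.range f), x u ∈ Submodule.span ℝ (Set.range f) := by
  have : Submodule.span ℝ (Set.range f) ≤ (Submodule.span ℝ (Set.range f)).comap x := by
    rw [Submodule.span_le]
    rintro _ ⟨i, rfl⟩
    exact h i
  exact fun u hu => this hu

theorem CliffordSubdim.zero_one : CliffordSubdim 0 1 2 := by
  intro V _ _ _ _ P Q hP hQ hPQ
  obtain rfl := List.length_eq_zero_iff.1 hP
  obtain ⟨a, rfl⟩ := List.length_eq_one_iff.1 hQ
  obtain ⟨v, hv⟩ := exists_ne (0 : V)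
  have haa : ∀ v, a (a v) = -v := fun v => LinearMap.congr_fun (hPQ.sq_neg a (by simp)) v
  have hind : LinearIndependent ℝ ![v, a v] := by
    rw [LinearIndependent.pair_iff]
    intro s t hst
    have h2 := congrArg (fun w => s • w - t • a w) hst
    simp only [map_add, map_smul, haa, map_zero] at h2
    have h3 : (s * s + t * t) • v = 0 := by
      rw [← sub_eq_zero] at h2
      rw [← h2]
      module
    have := (smul_eq_zero.1 h3).resolve_right hv
    constructor <;> nlinarith
  refine ⟨_, finrank_span_eq_card hind, ?_⟩
  simp only [List.nil_append, List.mem_singleton, forall_eq]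
  have hm := fun i => Submodule.subset_span (R := ℝ) (Set.mem_range_self (f := ![v, a v]) i)
  refine mem_span_range_of_forall fun i => ?_
  fin_cases i
  · exact hm 1
  · simpa [haa] using hm 0

theorem exists_quaternionic {V : Type*} [AddCommGroup V] [Module ℝ V] {a b : Module.End ℝ V}
    (ha : a * a = -1) (hb : b * b = -1) (hab : a * b = -(b * a)) {v : V} (hv : v ≠ 0) :
    ∃ U : Submodule ℝ V, Module.finrank ℝ U = 4 ∧ U = Submodule.span ℝ {v, a v, b v, a (b v)} ∧
      (∀ u ∈ U, a u ∈ U) ∧ ∀ u ∈ U, b u ∈ U := by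
  have haa : ∀ v, a (a v) = -v := fun v => LinearMap.congr_fun ha v
  have hbb : ∀ v, b (b v) = -v := fun v => LinearMap.congr_fun hb v
  have hba : ∀ v, b (a v) = -a (b v) := fun v => LinearMap.congr_fun (anticomm_symm hab) v
  have hind : LinearIndependent ℝ ![v, a v, b v, a (b v)] := by
    rw [Fintype.linearIndependent_iff]
    intro g hg
    simp only [Fin.sum_univ_four, Matrix.cons_val] at hg
    have h2 := congrArg (fun w => g 0 • w - g 1 • a w - g 2 • b w - g 3 • a (b w)) hg
    simp only [map_add, map_smul, haa, hbb, hba, map_neg, map_zero] at h2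
    have h3 : (g 0 * g 0 + g 1 * g 1 + g 2 * g 2 + g 3 * g 3) • v = 0 := by
      rw [← sub_eq_zero] at h2
      rw [← h2]
      module
    have := (smul_eq_zero.1 h3).resolve_right hv
    intro i
    fin_cases i <;> simp only [Fin.zero_eta, Fin.mk_one, Fin.reduceFinMk] <;> nlinarith
  have hm := fun i =>
    Submodule.subset_span (R := ℝ) (Set.mem_range_self (f := ![v, a v, b v, a (b v)]) i)
  refine ⟨_, finrank_span_eq_card hind, ?_, mem_span_range_of_forall fun i => ?_,
    mem_span_range_of_forall fun i => ?_⟩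
  · congr 1
    ext w
    simp [eq_comm]
    tauto
  · fin_cases i
    · exact hm 1
    · simpa [haa] using hm 0
    · exact hm 3
    · simpa [haa] using hm 2
  · fin_cases i
    · exact hm 2
    · simpa [hba] using hm 3
    · simpa [hbb] using hm 0
    · simpa [hba, hbb] using hm 1

theorem CliffordSubdim.zero_two : CliffordSubdim 0 2 4 := by
  intro V _ _ _ _ P Q hP hQ hPQ
  obtain rfl := List.length_eq_zero_iff.1 hP
  obtain ⟨a, b, rfl⟩ := List.length_eq_two.1 hQ
  obtain ⟨v, hv⟩ := exists_ne (0 : V)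
  obtain ⟨U, hU, -, h⟩ := exists_quaternionic (hPQ.sq_neg a (by simp)) (hPQ.sq_neg b (by simp))
    (by simpa using hPQ.anti) hv
  exact ⟨U, hU, by simpa using h⟩

theorem CliffordSubdim.zero_three : CliffordSubdim 0 3 4 := by
  intro V _ _ _ _ P Q hP hQ hPQ
  obtain rfl := List.length_eq_zero_iff.1 hP
  obtain ⟨a, b, c, rfl⟩ := List.length_eq_three.1 hQ
  have ha := hPQ.sq_neg a (by simp)
  have hb := hPQ.sq_neg b (by simp)
  have hc := hPQ.sq_neg c (by simp)
  obtain ⟨⟨hab, hac⟩, hbc⟩ : (a * b = -(b * a) ∧ a * c = -(c * a)) ∧ b * c = -(c * b) := by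
    simpa using hPQ.anti
  have h1 := anticomm_symm hac
  have h2 := anticomm_symm hbc
  have h3 := anticomm_symm hab
  have sq : ∀ x : Module.End ℝ V, x * x = -1 → ∀ z, x * (x * z) = -z := fun x hx z => by
    rw [← mul_assoc, hx, neg_one_mul]
  have hga : a * b * c * a = a * (a * b * c) := by
    simp [mul_assoc, h1, anticomm_assoc h3]
  have hgb : a * b * c * b = b * (a * b * c) := by
    simp [mul_assoc, h2, anticomm_assoc h3]
  have hg : a * b * c * (a * b * c) = 1 := by
    simp [mul_assoc, h1, anticomm_assoc h1, h2, anticomm_assoc h2, h3, anticomm_assoc h3,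
      sq a ha, sq b hb, ha, hb, hc]
  have hcg : c = b * a * (a * b * c) := by
    simp [mul_assoc, sq a ha, sq b hb]
  obtain ⟨v, hv, hgv⟩ := exists_involution_eigenvector hg
  obtain ⟨U, hU, hUv, haU, hbU⟩ := exists_quaternionic ha hb hab hv
  refine ⟨U, hU, ?_⟩
  simp only [List.nil_append, List.mem_cons, forall_eq_or_imp, List.not_mem_nil, false_imp_iff,
    implies_true, and_true]
  refine ⟨haU, hbU, fun u hu => ?_⟩
  set g := a * b * c
  have hga' : ∀ w, g (a w) = a (g w) := LinearMap.congr_fun hga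
  have hgb' : ∀ w, g (b w) = b (g w) := LinearMap.congr_fun hgb
  obtain ⟨s, hs⟩ : ∃ s : ℝ, g v = s • v := by
    rcases hgv with h | h
    · exact ⟨1, by rw [h, one_smul]⟩
    · exact ⟨-1, by rw [h, neg_one_smul]⟩
  have hgU : U ≤ LinearMap.eqLocus g (s • 1) := by
    rw [hUv, Submodule.span_le]
    rintro x (rfl | rfl | rfl | rfl) <;> simp [hga', hgb', hs]
  have hgu : g u = s • u := hgU hu
  rw [hcg, Module.End.mul_apply, hgu, map_smul]
  exact U.smul_mem s (hbU _ (haU _ hu))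

/-- Every nonzero module over `q` anticommuting complex structures has a submodule of dimension
given by the Radon–Hurwitz table. -/
theorem cliffordSubdim_mfun : ∀ q, CliffordSubdim 0 q (mfun (q + 1))
  | 0 => CliffordSubdim.zero_zero
  | 1 => CliffordSubdim.zero_one
  | 2 => CliffordSubdim.zero_two
  | 3 => CliffordSubdim.zero_three
  | 4 => CliffordSubdim.zero_two.add_two.quad
  | 5 => CliffordSubdim.zero_one.add_two.succ_succ.quad
  | 6 => CliffordSubdim.zero_zero.add_two.succ_succ.succ_succ.quad
  | 7 => CliffordSubdim.one_zero.succ_succ.succ_succ.succ_succ.quad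
  | q + 8 => by
    have := (cliffordSubdim_mfun q).succ_succ.succ_succ.succ_succ.succ_succ.quad
    rw [← mul_assoc, ← mul_assoc, ← mul_assoc] at this
    exact this

theorem cliffordSubdim_succ (n : ℕ) (hn : 1 ≤ n) : CliffordSubdim (n + 1) 0 (2 * mfun n) := by
  obtain ⟨q, rfl⟩ := Nat.exists_eq_add_of_le' hn
  exact (cliffordSubdim_mfun q).add_two

/-- There is a `d`-dimensional system of real orthogonal anticommuting matrices with `p` symmetric
and `q` skew-symmetric members. -/
def CliffordMat (p q d : ℕ) : Prop :=
  ∃ (ι : Type) (_ : Fintype ι) (_ : DecidableEq ι) (P Q : List (Matrix ι ι ℝ)),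
    Fintype.card ι = d ∧ P.length = p ∧ Q.length = q ∧ IsClifford P Q ∧
      (∀ x ∈ P, xᵀ = x) ∧ ∀ x ∈ Q, xᵀ = -x

theorem CliffordMat.succ_succ {p q d : ℕ} (h : CliffordMat p q d) :
    CliffordMat (p + 1) (q + 1) (2 * d) := by
  obtain ⟨ι, _, _, P, Q, rfl, rfl, rfl, hPQ, hP, hQ⟩ := h
  set f : Matrix ι ι ℝ → Matrix (ι ⊕ ι) (ι ⊕ ι) ℝ := fun x => fromBlocks x 0 0 (-x) with hf
  refine ⟨ι ⊕ ι, inferInstance, inferInstance, fromBlocks 0 1 1 0 :: P.map f,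
    fromBlocks 0 1 (-1) 0 :: Q.map f, by simp [two_mul], by simp, by simp, ⟨?_, ?_, ?_⟩, ?_, ?_⟩
  · simp only [List.mem_cons, List.mem_map, forall_eq_or_imp, forall_exists_index, and_imp,
      forall_apply_eq_imp_iff₂]
    refine ⟨by simp [fromBlocks_multiply], fun x hx => ?_⟩
    simp [hf, fromBlocks_multiply, hPQ.sq_pos x hx]
  · simp only [List.mem_cons, List.mem_map, forall_eq_or_imp, forall_exists_index, and_imp,
      forall_apply_eq_imp_iff₂]
    refine ⟨by simp [fromBlocks_multiply, ← fromBlocks_one, fromBlocks_neg], fun x hx => ?_⟩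
    simp [hf, fromBlocks_multiply, hPQ.sq_neg x hx, ← fromBlocks_one, fromBlocks_neg]
  · have hperm : (fromBlocks 0 1 1 0 :: P.map f ++ fromBlocks 0 1 (-1) 0 :: Q.map f).Perm
        (fromBlocks 0 1 1 0 :: fromBlocks 0 1 (-1) 0 :: (P ++ Q).map f) := by
      simp
    rw [pairwise_anticomm_perm hperm]
    simp only [List.pairwise_cons, List.mem_cons, List.mem_map, forall_eq_or_imp,
      forall_exists_index, and_imp, forall_apply_eq_imp_iff₂, List.pairwise_map]
    refine ⟨⟨?_, fun x _ => ?_⟩, fun x _ => ?_, hPQ.anti.imp fun {x y} hxy => ?_⟩ <;>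
    simp [hf, fromBlocks_multiply, fromBlocks_neg]
    exact hxy
  · simp only [List.mem_cons, List.mem_map, forall_eq_or_imp, forall_exists_index, and_imp,
      forall_apply_eq_imp_iff₂]
    refine ⟨by simp [fromBlocks_transpose], fun x hx => ?_⟩
    simp [hf, fromBlocks_transpose, hP x hx]
  · simp only [List.mem_cons, List.mem_map, forall_eq_or_imp, forall_exists_index, and_imp,
      forall_apply_eq_imp_iff₂]
    refine ⟨by simp [fromBlocks_transpose, fromBlocks_neg], fun x hx => ?_⟩
    simp [hf, fromBlocks_transpose, fromBlocks_neg, hQ x hx]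

theorem CliffordMat.add_two {q d : ℕ} (h : CliffordMat 0 q d) :
    CliffordMat (q + 2) 0 (2 * d) := by
  obtain ⟨ι, _, _, P, Q, rfl, hP0, rfl, hPQ, -, hQ⟩ := h
  obtain rfl := List.length_eq_zero_iff.1 hP0
  set f : Matrix ι ι ℝ → Matrix (ι ⊕ ι) (ι ⊕ ι) ℝ := fun x => fromBlocks 0 x (-x) 0 with hf
  refine ⟨ι ⊕ ι, inferInstance, inferInstance,
    fromBlocks 0 1 1 0 :: fromBlocks 1 0 0 (-1) :: Q.map f, [], by simp [two_mul], by simp,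
    by simp, ⟨?_, by simp, ?_⟩, ?_, by simp⟩
  · simp only [List.mem_cons, List.mem_map, forall_eq_or_imp, forall_exists_index, and_imp,
      forall_apply_eq_imp_iff₂]
    refine ⟨by simp [fromBlocks_multiply], by simp [fromBlocks_multiply], fun x hx => ?_⟩
    simp [hf, fromBlocks_multiply, hPQ.sq_neg x hx]
  · simp only [List.append_nil, List.pairwise_cons, List.mem_cons, List.mem_map, forall_eq_or_imp,
      forall_exists_index, and_imp, forall_apply_eq_imp_iff₂, List.pairwise_map]
    refine ⟨⟨?_, fun x _ => ?_⟩, fun x _ => ?_, hPQ.anti.imp fun {x y} hxy => ?_⟩ <;>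
    simp [hf, fromBlocks_multiply, fromBlocks_neg]
    rw [hxy, neg_neg]
  · simp only [List.mem_cons, List.mem_map, forall_eq_or_imp, forall_exists_index, and_imp,
      forall_apply_eq_imp_iff₂]
    refine ⟨by simp [fromBlocks_transpose], by simp [fromBlocks_transpose], fun x hx => ?_⟩
    simp [hf, fromBlocks_transpose, hQ x hx]

set_option linter.unusedSimpArgs false in
theorem CliffordMat.quad {p q d : ℕ} (h : CliffordMat (p + 4) q d) :
    CliffordMat p (q + 4) d := by
  obtain ⟨ι, _, _, P, Q, hd, hp, hq, hPQ, hP, hQ⟩ := h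
  obtain ⟨a, b, c, e, P, rfl⟩ : ∃ a b c e P', P = a :: b :: c :: e :: P' := by
    match P, hp with
    | a :: b :: c :: e :: P', _ => exact ⟨a, b, c, e, P', rfl⟩
  refine ⟨ι, _, _, P, _, hd, by simpa using hp, by simpa using hq, hPQ.quad_pos_to_neg,
    fun x hx => hP x (by simp [hx]), ?_⟩
  have hanti := (List.pairwise_append.1 hPQ.anti).1
  simp only [List.pairwise_cons, List.mem_cons, forall_eq_or_imp] at hP hanti ⊢
  obtain ⟨ha, hb, hc, he, -⟩ := hP
  obtain ⟨⟨hab, hac, hae, -⟩, ⟨hbc, hbe, -⟩, ⟨hce, -⟩, -⟩ := hanti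
  have ab := anticomm_symm hab
  have ac := anticomm_symm hac
  have ae := anticomm_symm hae
  have bc := anticomm_symm hbc
  have be := anticomm_symm hbe
  have ce := anticomm_symm hce
  have haa := hPQ.sq_pos a (by simp)
  have hbb := hPQ.sq_pos b (by simp)
  have hcc := hPQ.sq_pos c (by simp)
  have hee := hPQ.sq_pos e (by simp)
  have sq : ∀ x : Matrix ι ι ℝ, x * x = 1 → ∀ z, x * (x * z) = z := fun x hx z => by
    rw [← mul_assoc, hx, one_mul]
  refine ⟨?_, ?_, ?_, ?_, hQ⟩ <;>
  simp only [transpose_mul, transpose_neg, mul_one, neg_mul, haa, hbb, hcc, hee, sq a haa,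
    sq b hbb, sq c hcc, sq e hee, ha, hb, hc, he, mul_assoc, ab, anticomm_assoc ab, ac,
    anticomm_assoc ac, ae, anticomm_assoc ae, bc, anticomm_assoc bc, be, anticomm_assoc be, ce,
    anticomm_assoc ce, mul_neg, neg_neg]

theorem CliffordMat.mono {p q d : ℕ} (h : CliffordMat p (q + 1) d) : CliffordMat p q d := by
  obtain ⟨ι, _, _, P, Q, hd, hp, hq, hPQ, hP, hQ⟩ := h
  obtain ⟨a, Q, rfl⟩ := List.exists_cons_of_length_eq_add_one hq
  have hperm : (P ++ a :: Q).Perm (a :: (P ++ Q)) := by simp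
  exact ⟨ι, _, _, P, Q, hd, hp, by simpa using hq,
    ⟨hPQ.sq_pos, fun x hx => hPQ.sq_neg x (by simp [hx]),
      (List.pairwise_cons.1 ((pairwise_anticomm_perm hperm).1 hPQ.anti)).2⟩,
    hP, fun x hx => hQ x (by simp [hx])⟩

theorem CliffordMat.one_zero : CliffordMat 1 0 1 :=
  ⟨Unit, inferInstance, inferInstance, [1], [], by simp, rfl, rfl,
    ⟨by simp, by simp, by simp⟩, by simp, by simp⟩

theorem CliffordMat.zero_zero : CliffordMat 0 0 1 :=
  ⟨Unit, inferInstance, inferInstance, [], [], by simp, rfl, rfl,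
    ⟨by simp, by simp, by simp⟩, by simp, by simp⟩

theorem CliffordMat.zero_one : CliffordMat 0 1 2 := by
  obtain ⟨ι, _, _, P, Q, hd, hp, hq, hPQ, hP, hQ⟩ := CliffordMat.zero_zero.succ_succ
  exact ⟨ι, _, _, [], Q, hd, rfl, hq,
    ⟨by simp, hPQ.sq_neg, (List.pairwise_append.1 hPQ.anti).2.1⟩, by simp, hQ⟩

theorem CliffordMat.zero_three : CliffordMat 0 3 4 := by
  refine ⟨Fin 4, inferInstance, inferInstance, [],
    [!![0, 1, 0, 0; -1, 0, 0, 0; 0, 0, 0, 1; 0, 0, -1, 0],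
      !![0, 0, 1, 0; 0, 0, 0, -1; -1, 0, 0, 0; 0, 1, 0, 0],
      !![0, 0, 0, 1; 0, 0, 1, 0; 0, -1, 0, 0; -1, 0, 0, 0]], by simp, rfl, rfl,
    ⟨by simp, ?_, ?_⟩, by simp, ?_⟩
  · simp only [List.mem_cons, forall_eq_or_imp, List.not_mem_nil, false_imp_iff, implies_true,
      and_true]
    refine ⟨?_, ?_, ?_⟩ <;> ext i j <;> fin_cases i <;> fin_cases j <;>
      simp [Matrix.mul_apply, Fin.sum_univ_four]
  · simp only [List.nil_append, List.pairwise_cons, List.mem_cons, forall_eq_or_imp,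
      List.not_mem_nil, false_imp_iff, implies_true, and_true, List.Pairwise.nil]
    refine ⟨⟨?_, ?_⟩, ?_⟩ <;> ext i j <;> fin_cases i <;> fin_cases j <;>
      simp [Matrix.mul_apply, Fin.sum_univ_four]
  · simp only [List.mem_cons, forall_eq_or_imp, List.not_mem_nil, false_imp_iff, implies_true,
      and_true]
    refine ⟨?_, ?_, ?_⟩ <;> ext i j <;> fin_cases i <;> fin_cases j <;> simp

theorem cliffordMat_mfun : ∀ q, CliffordMat 0 q (mfun (q + 1))
  | 0 => CliffordMat.zero_zero
  | 1 => CliffordMat.zero_one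
  | 2 => CliffordMat.zero_three.mono
  | 3 => CliffordMat.zero_three
  | 4 => CliffordMat.zero_three.mono.add_two.quad
  | 5 => CliffordMat.zero_one.add_two.succ_succ.quad
  | 6 => CliffordMat.zero_zero.add_two.succ_succ.succ_succ.quad
  | 7 => CliffordMat.one_zero.succ_succ.succ_succ.succ_succ.quad
  | q + 8 => by
    have := (cliffordMat_mfun q).succ_succ.succ_succ.succ_succ.succ_succ.quad
    rw [← mul_assoc, ← mul_assoc, ← mul_assoc] at this
    exact this

theorem pderiv_eq_of_hasDerivAt {m : ℕ} {i : Fin m} {f : (Fin m → ℝ) → ℝ} {x : Fin m → ℝ} {c : ℝ}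
    (hf : DifferentiableAt ℝ f x)
    (h : HasDerivAt (fun t : ℝ => f (x + t • Pi.single i 1)) c 0) : pderiv i f x = c := by
  have := hf.hasFDerivAt.hasLineDerivAt (Pi.single i 1)
  exact HasDerivAt.unique this h

theorem pderiv_mulVec {m : ℕ} (A : Matrix (Fin m) (Fin m) ℝ) (i : Fin m) (x : Fin m → ℝ) :
    pderiv i (fun y => 2 * A.mulVec y i) x = 2 * A i i := by
  refine pderiv_eq_of_hasDerivAt (by simp only [mulVec, dotProduct]; fun_prop) ?_
  have : (fun t : ℝ => 2 * A.mulVec (x + t • Pi.single i 1) i) =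
      fun t => 2 * A.mulVec x i + 2 * A i i * t := by
    funext t
    simp [mulVec_add, mulVec_smul]
    ring
  rw [this]
  simpa using ((hasDerivAt_id (0 : ℝ)).const_mul (2 * A i i)).const_add (2 * A.mulVec x i)

theorem Matrix.IsSymm.dotProduct_mulVec_comm {m : ℕ} {A : Matrix (Fin m) (Fin m) ℝ}
    (hA : A.IsSymm) (x y : Fin m → ℝ) : x ⬝ᵥ A.mulVec y = A.mulVec x ⬝ᵥ y := by
  rw [dotProduct_mulVec, ← mulVec_transpose, hA.eq]

theorem pderiv_quadratic {m : ℕ} {A : Matrix (Fin m) (Fin m) ℝ} (hA : A.IsSymm) (i : Fin m) :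
    pderiv i (fun y => y ⬝ᵥ A.mulVec y) = fun x => 2 * A.mulVec x i := by
  funext x
  refine pderiv_eq_of_hasDerivAt (by simp only [mulVec, dotProduct]; fun_prop) ?_
  have : (fun t : ℝ => (x + t • Pi.single i 1) ⬝ᵥ A.mulVec (x + t • Pi.single i 1)) =
      fun t => x ⬝ᵥ A.mulVec x + 2 * A.mulVec x i * t + A i i * t ^ 2 := by
    funext t
    have h1 : x ⬝ᵥ A.mulVec (Pi.single i 1) = A.mulVec x i := by
      rw [hA.dotProduct_mulVec_comm]
      simp
    rw [mulVec_add, mulVec_smul, add_dotProduct, dotProduct_add, dotProduct_add, dotProduct_smul,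
      smul_dotProduct, smul_dotProduct, dotProduct_smul, h1]
    simp
    ring
  rw [this]
  have h1 : HasDerivAt (fun t : ℝ => x ⬝ᵥ A.mulVec x + 2 * A.mulVec x i * t)
      (2 * A.mulVec x i) 0 := by
    simpa using ((hasDerivAt_id (0 : ℝ)).const_mul (2 * A.mulVec x i)).const_add
      (x ⬝ᵥ A.mulVec x)
  have h2 : HasDerivAt (fun t : ℝ => A i i * t ^ 2) 0 0 := by
    simpa using (hasDerivAt_pow 2 (0 : ℝ)).const_mul (A i i)
  simpa using h1.fun_add h2

theorem Represents.isHarmonicMorphism_iff {m n : ℕ} {A : Fin n → Matrix (Fin m) (Fin m) ℝ}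
    {φ : (Fin m → ℝ) → Fin n → ℝ} (h : Represents A φ) :
    IsHarmonicMorphism φ ↔ (∀ α, (A α).trace = 0) ∧ ∃ lam : (Fin m → ℝ) → ℝ, ∀ x α β,
      4 * ((A α).mulVec x ⬝ᵥ (A β).mulVec x) = lam x ^ 2 * (if α = β then 1 else 0) := by
  have hφ : ∀ α, (fun y => φ y α) = fun y => y ⬝ᵥ (A α).mulVec y := fun α =>
    funext fun y => h.2.2 y α
  have h1 : ∀ α x, ∑ i : Fin m, pderiv i (pderiv i fun y => φ y α) x = 2 * (A α).trace := by
    intro α x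
    simp only [hφ, pderiv_quadratic (h.1 α), pderiv_mulVec, Matrix.trace, Matrix.diag,
      Finset.mul_sum]
  have h2 : ∀ x α β, ∑ i : Fin m, pderiv i (fun y => φ y α) x * pderiv i (fun y => φ y β) x =
      4 * ((A α).mulVec x ⬝ᵥ (A β).mulVec x) := by
    intro x α β
    simp only [hφ, pderiv_quadratic (h.1 _)]
    simp only [dotProduct, Finset.mul_sum]
    exact Finset.sum_congr rfl fun i _ => by ring
  simp only [IsHarmonicMorphism, h1, h2, mul_eq_zero, OfNat.ofNat_ne_zero, false_or, forall_const]

theorem Matrix.IsSymm.eq_zero_of_forall_dotProduct {m : ℕ} {N : Matrix (Fin m) (Fin m) ℝ}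
    (hN : N.IsSymm) (h : ∀ x, x ⬝ᵥ N.mulVec x = 0) : N = 0 := by
  ext i j
  have hij := h (Pi.single i 1 + Pi.single j 1)
  have hi := h (Pi.single i 1)
  have hj := h (Pi.single j 1)
  rw [mulVec_add, dotProduct_add, add_dotProduct, add_dotProduct, hi, hj] at hij
  have hs := hN.apply i j
  simp at hij
  simp
  linarith

/-- The algebraic relations between the component matrices of a quadratic harmonic morphism. -/
theorem Represents.relations {m n : ℕ} {A : Fin n → Matrix (Fin m) (Fin m) ℝ}
    {φ : (Fin m → ℝ) → Fin n → ℝ} (h : Represents A φ) (hφ : IsHarmonicMorphism φ) :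
    (∀ α β, A α * A α = A β * A β) ∧ ∀ α β, α ≠ β → A α * A β = -(A β * A α) := by
  obtain ⟨-, lam, hlam⟩ := h.isHarmonicMorphism_iff.1 hφ
  have hdot : ∀ α β x, x ⬝ᵥ (A α * A β).mulVec x = (A α).mulVec x ⬝ᵥ (A β).mulVec x := by
    intro α β x
    rw [← mulVec_mulVec, (h.1 α).dotProduct_mulVec_comm]
  constructor
  · intro α β
    rw [← sub_eq_zero]
    refine Matrix.IsSymm.eq_zero_of_forall_dotProduct ?_ fun x => ?_
    · simp [Matrix.IsSymm, (h.1 _).eq]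
    · rw [sub_mulVec, dotProduct_sub, hdot, hdot]
      have h1 := hlam x α α
      have h2 := hlam x β β
      simp only [if_true] at h1 h2
      linarith
  · intro α β hαβ
    rw [← sub_eq_zero, sub_neg_eq_add]
    refine Matrix.IsSymm.eq_zero_of_forall_dotProduct ?_ fun x => ?_
    · simp [Matrix.IsSymm, (h.1 _).eq, add_comm]
    · rw [add_mulVec, dotProduct_add, hdot, hdot]
      have h1 := hlam x α β
      have h2 := hlam x β α
      rw [if_neg hαβ] at h1
      rw [if_neg hαβ.symm] at h2
      linarith

theorem IsCliffordSystem.mul_self {N n : ℕ} {P : Fin n → Matrix (Fin N) (Fin N) ℝ}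
    (h : IsCliffordSystem P) (i : Fin n) : P i * P i = 1 := by
  have := h.2 i i
  rw [if_pos rfl, ← two_smul ℝ] at this
  exact smul_right_injective _ (two_ne_zero' ℝ) this

theorem IsCliffordSystem.anticomm {N n : ℕ} {P : Fin n → Matrix (Fin N) (Fin N) ℝ}
    (h : IsCliffordSystem P) {i j : Fin n} (hij : i ≠ j) : P i * P j = -(P j * P i) := by
  have := h.2 i j
  rw [if_neg hij] at this
  exact eq_neg_of_add_eq_zero_left this

theorem isCliffordSystem_of {N n : ℕ} {P : Fin n → Matrix (Fin N) (Fin N) ℝ}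
    (hs : ∀ i, (P i).IsSymm) (h1 : ∀ i, P i * P i = 1)
    (h2 : ∀ i j, i ≠ j → P i * P j = -(P j * P i)) : IsCliffordSystem P := by
  refine ⟨hs, fun i j => ?_⟩
  split_ifs with hij
  · rw [hij, h1, two_smul]
  · rw [h2 i j hij, neg_add_cancel]

theorem IsCliffordSystem.represents {N n : ℕ} (hN : 0 < N) {P : Fin n → Matrix (Fin N) (Fin N) ℝ}
    (h : IsCliffordSystem P) : Represents P (cliffordMap P) := by
  refine ⟨h.1, fun α h0 => ?_, fun _ _ => rfl⟩
  have : Nonempty (Fin N) := ⟨⟨0, hN⟩⟩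
  have h1 := h.mul_self α
  rw [h0, zero_mul] at h1
  exact zero_ne_one h1

theorem exists_ne_of_one_le {n : ℕ} (hn : 1 ≤ n) (α : Fin (n + 1)) : ∃ β, β ≠ α := by
  have : Nontrivial (Fin (n + 1)) := Fin.nontrivial_iff_two_le.2 (by omega)
  exact exists_ne α

theorem IsCliffordSystem.isQuadraticHM {N n : ℕ} (hN : 0 < N) (hn : 1 ≤ n)
    {P : Fin (n + 1) → Matrix (Fin N) (Fin N) ℝ} (h : IsCliffordSystem P) :
    IsQuadraticHM (cliffordMap P) := by
  refine ⟨⟨P, h.represents hN⟩, (h.represents hN).isHarmonicMorphism_iff.2 ⟨fun α => ?_,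
    fun x => 2 * √(x ⬝ᵥ x), fun x α β => ?_⟩⟩
  · obtain ⟨β, hβ⟩ := exists_ne_of_one_le hn α
    have h1 : (P α).trace = -(P α).trace := by
      conv_lhs => rw [← mul_one (P α), ← h.mul_self β, ← mul_assoc, h.anticomm hβ.symm,
        neg_mul, trace_neg, trace_mul_comm, ← mul_assoc, h.mul_self, one_mul]
    linarith
  · have h1 : (P α).mulVec x ⬝ᵥ (P β).mulVec x = x ⬝ᵥ (P α * P β).mulVec x := by
      rw [← mulVec_mulVec, (h.1 α).dotProduct_mulVec_comm]
    split_ifs with hαβ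
    · rw [h1, hαβ, h.mul_self, one_mulVec, mul_one, mul_pow, Real.sq_sqrt]
      · norm_num
      · exact Finset.sum_nonneg fun i _ => mul_self_nonneg _
    · have h2 : (P α).mulVec x ⬝ᵥ (P β).mulVec x = x ⬝ᵥ (P β * P α).mulVec x := by
        rw [← mulVec_mulVec, (h.1 β).dotProduct_mulVec_comm, dotProduct_comm]
      rw [h.anticomm hαβ, neg_mulVec, dotProduct_neg, ← h2] at h1
      linarith

theorem IsCliffordSystem.memH21 {N n : ℕ} (hN : 0 < N) (hn : 1 ≤ n)
    {P : Fin (n + 1) → Matrix (Fin N) (Fin N) ℝ} (h : IsCliffordSystem P) :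
    MemH21 (cliffordMap P) := by
  refine ⟨h.isQuadraticHM hN hn, P, h.represents hN, fun α => ⟨?_, ?_⟩⟩
  · have : Nonempty (Fin N) := ⟨⟨0, hN⟩⟩
    obtain ⟨v, hv, hPv⟩ := exists_involution_eigenvector (V := Fin N → ℝ)
      (a := (P α).mulVecLin) (by
        rw [Module.End.mul_eq_comp, ← mulVecLin_mul, h.mul_self, mulVecLin_one]; rfl)
    simp only [mulVecLin_apply] at hPv
    rcases hPv with hPv | hPv
    · exact ⟨v, hv, by rw [hPv, one_smul]⟩
    · obtain ⟨β, hβ⟩ := exists_ne_of_one_le hn α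
      refine ⟨(P β).mulVec v, fun h0 => hv ?_, ?_⟩
      · rw [← one_mulVec v, ← h.mul_self β, ← mulVec_mulVec, h0, mulVec_zero]
      · rw [mulVec_mulVec, h.anticomm hβ.symm, neg_mulVec, ← mulVec_mulVec, hPv, mulVec_neg,
          neg_neg, one_smul]
  · rintro μ hμ ⟨v, hv, hPv⟩
    have h1 : (μ * μ) • v = (1 : ℝ) • v := by
      rw [one_smul, mul_smul, ← hPv, ← mulVec_smul, ← hPv, mulVec_mulVec, h.mul_self, one_mulVec]
    have h2 := smul_left_injective ℝ hv h1
    nlinarith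

theorem exists_isCliffordSystem {n k : ℕ} (hn : 1 ≤ n) :
    ∃ P : Fin (n + 1) → Matrix (Fin (2 * k * mfun n)) (Fin (2 * k * mfun n)) ℝ,
      IsCliffordSystem P := by
  have hmat : CliffordMat (n + 1) 0 (2 * mfun n) := by
    obtain ⟨q, rfl⟩ := Nat.exists_eq_add_of_le' hn
    exact (cliffordMat_mfun q).add_two
  obtain ⟨ι, _, _, L, Q, hd, hp, hq, hPQ, hP, -⟩ := hmat
  obtain rfl := List.length_eq_zero_iff.1 hq
  have hcard : Fintype.card (ι × Fin k) = 2 * k * mfun n := by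
    rw [Fintype.card_prod, hd, Fintype.card_fin]
    ring
  let e : ι × Fin k ≃ Fin (2 * k * mfun n) := Fintype.equivFinOfCardEq hcard
  let f : Fin (n + 1) → Matrix ι ι ℝ := fun i => L.get (i.cast hp.symm)
  have hf : ∀ i, f i ∈ L := fun i => List.get_mem _ _
  have hanti : ∀ i j, i < j → f i * f j = -(f j * f i) := fun i j hij =>
    List.pairwise_iff_get.1 (by simpa using hPQ.anti) (i.cast hp.symm) (j.cast hp.symm) hij
  refine ⟨fun i => reindex e e (blockDiagonal fun _ => f i), isCliffordSystem_of ?_ ?_ ?_⟩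
  · intro i
    simp [Matrix.IsSymm, blockDiagonal_transpose, hP _ (hf i)]
  · intro i
    simp only [reindex_apply, submatrix_mul_equiv, ← blockDiagonal_mul, hPQ.sq_pos _ (hf i)]
    exact (congrArg (fun M => submatrix M e.symm e.symm) blockDiagonal_one).trans (submatrix_one_equiv _)
  · intro i j hij
    have : f i * f j = -(f j * f i) := by
      rcases lt_or_gt_of_ne hij with h | h
      · exact hanti i j h
      · rw [hanti j i h, neg_neg]
    simp only [reindex_apply, submatrix_mul_equiv, ← blockDiagonal_mul, this]
    exact congrArg (fun M => submatrix M e.symm e.symm) (blockDiagonal_neg _)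

theorem IsCliffordSystem.qNonsingular {N n : ℕ} (hN : 0 < N)
    {P : Fin n → Matrix (Fin N) (Fin N) ℝ} (h : IsCliffordSystem P) :
    QNonsingular (cliffordMap P) :=
  ⟨P, h.represents hN, fun α => by
    rw [rank_of_isUnit _ (IsUnit.of_mul_eq_one _ (h.mul_self α)), Fintype.card_fin]⟩

/-- Symmetric operators with equal squares which pairwise anticommute. -/
structure IsMorphismFamily {V : Type} [NormedAddCommGroup V] [InnerProductSpace ℝ V] {n : ℕ}
    (A : Fin n → Module.End ℝ V) : Prop where
  symm : ∀ α, (A α).IsSymmetric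
  sq_eq : ∀ α β, A α * A α = A β * A β
  anticomm : ∀ α β, α ≠ β → A α * A β = -(A β * A α)

theorem LinearMap.IsSymmetric.exists_eigenvector_ne_zero {V : Type} [NormedAddCommGroup V]
    [InnerProductSpace ℝ V] [FiniteDimensional ℝ V] {T : Module.End ℝ V} (hT : T.IsSymmetric)
    (h0 : T ≠ 0) : ∃ μ : ℝ, μ ≠ 0 ∧ ∃ v, v ≠ 0 ∧ T v = μ • v := by
  by_contra! h
  refine h0 ((hT.eigenvectorBasis rfl).toBasis.ext fun i => ?_)
  have h1 := hT.apply_eigenvectorBasis rfl i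
  have h2 : hT.eigenvectorBasis rfl i ≠ 0 := (hT.eigenvectorBasis rfl).orthonormal.ne_zero i
  by_cases hμ : hT.eigenvalues rfl i = 0
  · simp [hμ]
  · exact absurd h1 (h _ hμ _ h2)

theorem IsMorphismFamily.exists_submodule {V : Type} [NormedAddCommGroup V]
    [InnerProductSpace ℝ V] [FiniteDimensional ℝ V] {n : ℕ} (hn : 1 ≤ n)
    {A : Fin (n + 1) → Module.End ℝ V} (hA : IsMorphismFamily A) {W : Submodule ℝ V}
    (hW : ∀ α, ∀ w ∈ W, A α w ∈ W) (h0 : ∃ w ∈ W, A 0 w ≠ 0) :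
    ∃ U ≤ W, Module.finrank ℝ U = 2 * mfun n ∧ ∃ lam : ℝ, 0 < lam ∧
      ∀ α, ∀ u ∈ U, A α u ∈ U ∧ A α (A α u) = lam ^ 2 • u := by
  obtain ⟨μ, hμ, ⟨v, hvW⟩, hv, hAv⟩ :=
    ((hA.symm 0).restrict_invariant (hW 0)).exists_eigenvector_ne_zero (fun h => by
      obtain ⟨w, hw, hw0⟩ := h0
      exact hw0 (congrArg Subtype.val (LinearMap.congr_fun h ⟨w, hw⟩)))
  replace hAv : A 0 v = μ • v := congrArg Subtype.val hAv
  replace hv : v ≠ 0 := fun h => hv (Subtype.ext h)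
  have hsq : ∀ α u, A α (A α u) = A 0 (A 0 u) := fun α u => LinearMap.congr_fun (hA.sq_eq α 0) u
  let E : Submodule ℝ V := W ⊓ LinearMap.ker (A 0 * A 0 - algebraMap ℝ _ (|μ| ^ 2))
  have hE : ∀ {u}, u ∈ E ↔ u ∈ W ∧ A 0 (A 0 u) = |μ| ^ 2 • u := by
    intro u
    simp [E, sub_eq_zero, Algebra.algebraMap_eq_smul_one]
  have hEinv : ∀ α, ∀ u ∈ E, A α u ∈ E := by
    intro α u hu
    rw [hE] at hu ⊢
    refine ⟨hW α u hu.1, ?_⟩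
    rw [← hsq α (A α u), hsq α u, hu.2, map_smul]
  have hEbot : E ≠ ⊥ := by
    refine (Submodule.ne_bot_iff E).2 ⟨v, hE.2 ⟨hvW, ?_⟩, hv⟩
    rw [hAv, map_smul, hAv, smul_smul, sq_abs, pow_two]
  have hpos : 0 < |μ| := abs_pos.2 hμ
  obtain ⟨U, hUE, hUd, hU⟩ := (cliffordSubdim_succ n hn).exists_le hEbot
    (P := List.ofFn fun α => |μ|⁻¹ • A α) (Q := []) (List.length_ofFn) rfl
    (by
      simp only [List.append_nil, List.forall_mem_ofFn_iff]
      exact fun α w hw => E.smul_mem _ (hEinv α w hw))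
    (by
      simp only [List.forall_mem_ofFn_iff]
      intro α w hw
      simp only [LinearMap.smul_apply, map_smul]
      rw [hsq, (hE.1 hw).2, smul_smul, smul_smul]
      convert one_smul ℝ w
      field_simp)
    (by simp)
    (by
      rw [List.append_nil, List.pairwise_ofFn]
      intro i j hij w _
      have := LinearMap.congr_fun (hA.anticomm i j hij.ne) w
      simp only [Module.End.mul_apply, LinearMap.neg_apply] at this
      simp only [LinearMap.smul_apply, map_smul, this, smul_neg])
  simp only [List.append_nil, List.forall_mem_ofFn_iff] at hU
  refine ⟨U, hUE.trans inf_le_left, hUd, |μ|, hpos, fun α u hu => ⟨?_, ?_⟩⟩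
  · have := U.smul_mem |μ| (hU α u hu)
    rwa [LinearMap.smul_apply, smul_inv_smul₀ hpos.ne'] at this
  · rw [hsq]
    exact (hE.1 (hUE hu)).2

theorem mfun_pos : ∀ n, 0 < mfun n
  | 0 | 1 | 2 | 3 | 4 | 5 | 6 | 7 | 8 => by simp [mfun]
  | n + 9 => by
    have := mfun_pos (n + 1)
    rw [mfun]
    omega

/-- Orthonormal vectors grouped in blocks whose spans are invariant under the family `A`, the
members of which square to the scalar `(lam j) ^ 2` on the `j`-th block. -/
structure IsBlockFamily {V : Type} [NormedAddCommGroup V] [InnerProductSpace ℝ V] {n k d : ℕ}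
    (A : Fin n → Module.End ℝ V) (lam : Fin k → ℝ) (b : Fin k × Fin d → V) : Prop where
  pos : ∀ j, 0 < lam j
  orthonormal : Orthonormal ℝ b
  mem_span : ∀ α j i, A α (b (j, i)) ∈ Submodule.span ℝ (Set.range fun i' => b (j, i'))
  apply_apply : ∀ α j i, A α (A α (b (j, i))) = lam j ^ 2 • b (j, i)

theorem IsMorphismFamily.exists_isBlockFamily {V : Type} [NormedAddCommGroup V]
    [InnerProductSpace ℝ V] [FiniteDimensional ℝ V] {n : ℕ} (hn : 1 ≤ n)
    {A : Fin (n + 1) → Module.End ℝ V} (hA : IsMorphismFamily A)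
    (hinj : Function.Injective (A 0)) : ∀ k : ℕ,
    k * (2 * mfun n) < Module.finrank ℝ V + 2 * mfun n →
    ∃ (lam : Fin k → ℝ) (b : Fin k × Fin (2 * mfun n) → V), IsBlockFamily A lam b := by
  intro k
  induction k with
  | zero =>
    exact fun _ => ⟨fun j => j.elim0, fun p => p.1.elim0, fun j => j.elim0,
      ⟨fun p => p.1.elim0, fun p => p.1.elim0⟩, fun _ j => j.elim0, fun _ j => j.elim0⟩
  | succ k ih =>
    intro hk
    rw [add_mul, one_mul, add_lt_add_iff_right] at hk
    obtain ⟨lam, b, hb⟩ := ih (by omega)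
    set S := Submodule.span ℝ (Set.range b) with hS
    have hSinv : ∀ α, ∀ s ∈ S, A α s ∈ S := by
      intro α s hs
      refine (Submodule.span_le (p := S.comap (A α))).2 ?_ hs
      rintro _ ⟨⟨j, i⟩, rfl⟩
      exact Submodule.span_mono (Set.range_comp_subset_range (fun i' => (j, i')) b)
        (hb.mem_span α j i)
    have hSinv' : ∀ α, ∀ w ∈ Sᗮ, A α w ∈ Sᗮ := by
      intro α w hw s hs
      rw [← hA.symm α]
      exact hw _ (hSinv α s hs)
    have hSd : Module.finrank ℝ S = k * (2 * mfun n) := by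
      rw [hS, finrank_span_eq_card hb.orthonormal.linearIndependent]
      simp
    have hSbot : Sᗮ ≠ ⊥ := by
      intro h
      have := S.finrank_add_finrank_orthogonal
      rw [h, finrank_bot] at this
      omega
    obtain ⟨w, hw, hw0⟩ := Submodule.exists_mem_ne_zero_of_ne_bot hSbot
    obtain ⟨U, hUS, hUd, μ, hμ, hU⟩ := hA.exists_submodule hn hSinv'
      ⟨w, hw, fun h => hw0 (hinj (h.trans (map_zero _).symm))⟩
    let c : OrthonormalBasis (Fin (2 * mfun n)) ℝ U := (stdOrthonormalBasis ℝ U).reindex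
      (finCongr hUd)
    have hc : ∀ i i', inner ℝ (c i : V) (c i' : V) = if i = i' then 1 else 0 := fun i i' => by
      rw [← orthonormal_iff_ite.1 c.orthonormal i i']
      rfl
    have hbc : ∀ p i, inner ℝ (b p) (c i : V) = 0 := fun p i =>
      hUS (c i).2 _ (Submodule.subset_span ⟨p, rfl⟩)
    refine ⟨Fin.cons μ lam,
      fun p => Fin.cases (motive := fun _ => V) (c p.2 : V) (fun j => b (j, p.2)) p.1, ?_, ?_, ?_, ?_⟩
    · intro j
      refine Fin.cases hμ hb.pos j
    · rw [orthonormal_iff_ite]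
      rintro ⟨j, i⟩ ⟨j', i'⟩
      refine Fin.cases ?_ (fun j => ?_) j <;> refine Fin.cases ?_ (fun j' => ?_) j'
      · simpa using hc i i'
      · simpa [real_inner_comm, (Fin.succ_ne_zero _).symm] using hbc (j', i') i
      · simpa [Fin.succ_ne_zero] using hbc (j, i) i'
      · simpa using orthonormal_iff_ite.1 hb.orthonormal (j, i) (j', i')
    · intro α j i
      refine Fin.cases ?_ (fun j => ?_) j
      · have h1 : (⟨_, (hU α _ (c i).2).1⟩ : U) ∈ Submodule.span ℝ (Set.range c) := by
          rw [← c.coe_toBasis, c.toBasis.span_eq]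
          trivial
        have h2 := Submodule.mem_map_of_mem (f := U.subtype) h1
        rw [Submodule.map_span, ← Set.range_comp] at h2
        exact h2
      · exact hb.mem_span α j i
    · intro α j i
      refine Fin.cases ?_ (fun j => ?_) j
      · exact (hU α _ (c i).2).2
      · exact hb.apply_apply α j i

theorem IsBlockFamily.sum_inner_smul {V : Type} [NormedAddCommGroup V] [InnerProductSpace ℝ V]
    {n k d : ℕ} {A : Fin n → Module.End ℝ V} {lam : Fin k → ℝ} {b : Fin k × Fin d → V}
    (hb : IsBlockFamily A lam b) (α : Fin n) (j : Fin k) (i : Fin d) :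
    ∑ l, (inner ℝ (b (j, l)) (A α (b (j, i))) : ℝ) • b (j, l) = A α (b (j, i)) := by
  have h : ∀ y ∈ Submodule.span ℝ (Set.range fun i' => b (j, i')),
      ∑ l, (inner ℝ (b (j, l)) y : ℝ) • b (j, l) = y := by
    intro y hy
    induction hy using Submodule.span_induction with
    | mem y hy =>
      obtain ⟨i, rfl⟩ := hy
      simp [orthonormal_iff_ite.1 hb.orthonormal]
    | zero => simp
    | add y z _ _ hy hz =>
      conv_rhs => rw [← hy, ← hz]
      simp only [inner_add_right, add_smul, Finset.sum_add_distrib]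
    | smul a y _ hy =>
      conv_rhs => rw [← hy]
      simp only [inner_smul_right, mul_smul, Finset.smul_sum]
  exact h _ (hb.mem_span α j i)

/-- The matrices of the normalised restrictions of the family `A` to the `j`-th block. -/
noncomputable def blockMatrix {V : Type} [NormedAddCommGroup V] [InnerProductSpace ℝ V]
    {n k d : ℕ} (A : Fin n → Module.End ℝ V) (lam : Fin k → ℝ) (b : Fin k × Fin d → V)
    (j : Fin k) (α : Fin n) : Matrix (Fin d) (Fin d) ℝ :=
  Matrix.of fun i i' => (lam j)⁻¹ * inner ℝ (b (j, i)) (A α (b (j, i')))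

theorem IsBlockFamily.isCliffordSystem {V : Type} [NormedAddCommGroup V] [InnerProductSpace ℝ V]
    {n k d : ℕ} {A : Fin n → Module.End ℝ V} (hA : IsMorphismFamily A) {lam : Fin k → ℝ}
    {b : Fin k × Fin d → V} (hb : IsBlockFamily A lam b) (j : Fin k) :
    IsCliffordSystem (blockMatrix A lam b j) := by
  have hmul : ∀ α β i i', (blockMatrix A lam b j α * blockMatrix A lam b j β) i i' =
      (lam j)⁻¹ ^ 2 * inner ℝ (b (j, i)) (A α (A β (b (j, i')))) := by
    intro α β i i'
    conv_rhs => rw [← hA.symm α, ← hb.sum_inner_smul β j i', inner_sum, Finset.mul_sum]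
    simp only [Matrix.mul_apply, blockMatrix, Matrix.of_apply, inner_smul_right,
      hA.symm α _ _, map_smul]
    exact Finset.sum_congr rfl fun l _ => by ring
  have hl := (hb.pos j).ne'
  refine isCliffordSystem_of (fun α => ?_) (fun α => ?_) fun α β hαβ => ?_
  · ext i i'
    simp only [blockMatrix, Matrix.transpose_apply, Matrix.of_apply]
    rw [← hA.symm α, real_inner_comm]
  · ext i i'
    rw [hmul, hb.apply_apply, inner_smul_right, orthonormal_iff_ite.1 hb.orthonormal]
    simp only [Prod.mk.injEq, true_and, Matrix.one_apply]
    field_simp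
  · ext i i'
    have := LinearMap.congr_fun (hA.anticomm α β hαβ) (b (j, i'))
    simp only [Module.End.mul_apply, LinearMap.neg_apply] at this
    rw [Matrix.neg_apply, hmul, hmul, this, inner_neg_right, mul_neg]

theorem IsBlockFamily.inner_sum_apply {V : Type} [NormedAddCommGroup V] [InnerProductSpace ℝ V]
    {n k d : ℕ} {A : Fin n → Module.End ℝ V} (hA : IsMorphismFamily A) {lam : Fin k → ℝ}
    {b : Fin k × Fin d → V} (hb : IsBlockFamily A lam b) (c : Fin k × Fin d → ℝ) (α : Fin n) :
    inner ℝ (∑ p, c p • b p) (A α (∑ p, c p • b p)) =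
      ∑ j, lam j * cliffordMap (blockMatrix A lam b j) (fun i => c (j, i)) α := by
  have h0 : ∀ j i j' i', j' ≠ j → inner ℝ (b (j', i')) (A α (b (j, i))) = (0 : ℝ) := by
    intro j i j' i' hj
    rw [← hb.sum_inner_smul, inner_sum]
    refine Finset.sum_eq_zero fun l _ => ?_
    rw [inner_smul_right, orthonormal_iff_ite.1 hb.orthonormal, if_neg (by simp [hj]), mul_zero]
  simp only [map_sum, map_smul, sum_inner, inner_sum, inner_smul_right, inner_smul_left,
    Fintype.sum_prod_type, cliffordMap, dotProduct, mulVec, blockMatrix, Matrix.of_apply,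
    Finset.mul_sum]
  refine Finset.sum_congr rfl fun j _ => Finset.sum_congr rfl fun i _ => ?_
  rw [Finset.sum_eq_single j
    (fun j' _ hj => Finset.sum_eq_zero fun i' _ => by simp [h0 _ _ _ _ hj]) (by simp)]
  refine Finset.sum_congr rfl fun i' _ => ?_
  have := (hb.pos j).ne'
  rw [conj_trivial, ← hA.symm α, real_inner_comm]
  field_simp

theorem Represents.isMorphismFamily {m n : ℕ} {A : Fin n → Matrix (Fin m) (Fin m) ℝ}
    {φ : (Fin m → ℝ) → Fin n → ℝ} (h : Represents A φ) (hφ : IsHarmonicMorphism φ) :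
    IsMorphismFamily fun α => (A α).toEuclideanLin := by
  obtain ⟨h1, h2⟩ := h.relations hφ
  refine ⟨fun α => Matrix.isSymmetric_toEuclideanLin_iff.2 ?_, fun α β => ?_, fun α β hαβ => ?_⟩
  · rw [Matrix.IsHermitian, conjTranspose_eq_transpose_of_trivial, (h.1 α).eq]
  · simp only [Module.End.mul_eq_comp, ← Matrix.toLpLin_mul_same, h1 α β]
  · simp only [Module.End.mul_eq_comp, ← Matrix.toLpLin_mul_same, h2 α β hαβ, map_neg]

theorem Represents.exists_submodule {M n : ℕ} (hn : 1 ≤ n)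
    {A : Fin (n + 1) → Matrix (Fin M) (Fin M) ℝ}
    {φ : (Fin M → ℝ) → Fin (n + 1) → ℝ} (h : Represents A φ) (hφ : IsHarmonicMorphism φ) :
    ∃ U : Submodule ℝ (EuclideanSpace ℝ (Fin M)), Module.finrank ℝ U = 2 * mfun n ∧
      ∃ lam : ℝ, 0 < lam ∧ ∀ α, ∀ u ∈ U,
        (A α).toEuclideanLin ((A α).toEuclideanLin u) = lam ^ 2 • u := by
  have h0 : (A 0).toEuclideanLin ≠ 0 := fun h0 =>
    h.2.1 0 ((LinearEquiv.map_eq_zero_iff _).1 h0)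
  obtain ⟨w, hw⟩ : ∃ w, (A 0).toEuclideanLin w ≠ 0 := by
    by_contra! hw
    exact h0 (LinearMap.ext hw)
  obtain ⟨U, -, hUd, lam, hlam, hU⟩ := (h.isMorphismFamily hφ).exists_submodule hn
    (W := ⊤) (fun _ _ _ => trivial) ⟨w, trivial, hw⟩
  exact ⟨U, hUd, lam, hlam, fun α u hu => (hU α u hu).2⟩

theorem IsQuadraticHM.two_mul_mfun_le {M n : ℕ} (hn : 1 ≤ n)
    {φ : (Fin M → ℝ) → Fin (n + 1) → ℝ} (hφ : IsQuadraticHM φ) : 2 * mfun n ≤ M := by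
  obtain ⟨⟨A, hA⟩, hφ⟩ := hφ
  obtain ⟨U, hU, -⟩ := hA.exists_submodule hn hφ
  simpa [hU] using U.finrank_le

theorem IsQuadraticHM.domainMinimal {n : ℕ} (hn : 1 ≤ n)
    {φ : (Fin (2 * mfun n) → ℝ) → Fin (n + 1) → ℝ} (hφ : IsQuadraticHM φ) : DomainMinimal φ :=
  ⟨hφ, fun _ hM ⟨_, hψ⟩ => hM.not_ge (hψ.two_mul_mfun_le hn)⟩

theorem QNonsingular.exists_isBlockFamily {M n : ℕ} (hn : 1 ≤ n)
    {φ : (Fin M → ℝ) → Fin (n + 1) → ℝ} (hφ : IsQuadraticHM φ) (h : QNonsingular φ) :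
    ∃ A : Fin (n + 1) → Matrix (Fin M) (Fin M) ℝ, Represents A φ ∧
      ∀ k : ℕ, k * (2 * mfun n) < M + 2 * mfun n →
        ∃ (lam : Fin k → ℝ) (b : Fin k × Fin (2 * mfun n) → EuclideanSpace ℝ (Fin M)),
          IsBlockFamily (fun α => (A α).toEuclideanLin) lam b := by
  obtain ⟨A, hA, hr⟩ := h
  refine ⟨A, hA, fun k hk => (hA.isMorphismFamily hφ.2).exists_isBlockFamily hn ?_ k (by simpa)⟩
  have hu : IsUnit (A 0) := by
    rw [← Matrix.linearIndependent_rows_iff_isUnit, linearIndependent_iff_card_eq_finrank_span,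
      Set.finrank, ← Matrix.rank_eq_finrank_span_row, hr 0, Fintype.card_fin]
  intro x y hxy
  have := congrArg WithLp.ofLp hxy
  simp only [Matrix.ofLp_toLpLin, Matrix.toLin'_apply] at this
  exact WithLp.ofLp_injective _ (Matrix.mulVec_injective_iff_isUnit.2 hu this)

theorem QNonsingular.exists_eq {M n : ℕ} (hn : 1 ≤ n)
    {φ : (Fin M → ℝ) → Fin (n + 1) → ℝ} (hφ : IsQuadraticHM φ) (h : QNonsingular φ) :
    ∃ k : ℕ, 0 < k ∧ M = 2 * k * mfun n := by
  obtain ⟨A, -, hA⟩ := h.exists_isBlockFamily hn hφ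
  have hpos := mfun_pos n
  have hle := hφ.two_mul_mfun_le hn
  have hmod := Nat.div_add_mod M (2 * mfun n)
  have hlt := Nat.mod_lt M (Nat.mul_pos two_pos hpos)
  refine ⟨M / (2 * mfun n), Nat.div_pos hle (by omega), ?_⟩
  by_contra hne
  have hmod0 : M % (2 * mfun n) ≠ 0 := fun h0 => hne (by
    conv_lhs => rw [← hmod, h0]
    ring)
  obtain ⟨lam, b, hb⟩ := hA (M / (2 * mfun n) + 1) (by
    rw [add_mul, mul_comm (M / _)]
    omega)
  have hcard := hb.orthonormal.linearIndependent.fintype_card_le_finrank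
  simp only [Fintype.card_prod, Fintype.card_fin, finrank_euclideanSpace] at hcard
  rw [add_mul, mul_comm (M / _)] at hcard
  omega

theorem IsBlockFamily.domainEquiv {k d n : ℕ} {M : ℕ} (h : M = k * d)
    {A : Fin n → Matrix (Fin M) (Fin M) ℝ} {φ : (Fin M → ℝ) → Fin n → ℝ}
    (hA : Represents A φ) (hφ : IsHarmonicMorphism φ) {lam : Fin k → ℝ}
    {b : Fin k × Fin d → EuclideanSpace ℝ (Fin M)}
    (hb : IsBlockFamily (fun α => (A α).toEuclideanLin) lam b) :
    DomainEquiv φ (reMap h (bigDSum fun j x =>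
      lam j • cliffordMap (blockMatrix (fun α => (A α).toEuclideanLin) lam b j) x)) := by
  let e : Fin k × Fin d ≃ Fin M := finProdFinEquiv.trans (finCongr h.symm)
  let c : OrthonormalBasis (Fin k × Fin d) ℝ (EuclideanSpace ℝ (Fin M)) :=
    OrthonormalBasis.mk hb.orthonormal (by
      rw [hb.orthonormal.linearIndependent.span_eq_top_of_card_eq_finrank' (by simp [h])])
  have hc : ∀ p, c p = b p := fun p => congrFun (OrthonormalBasis.coe_mk _ _) p
  let G : Matrix (Fin M) (Fin M) ℝ := Matrix.of fun p => (b (e.symm p)).ofLp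
  have hGx : ∀ x q, G.mulVec x (e q) = inner ℝ (c q) (WithLp.toLp 2 x) := by
    intro x q
    simp [G, hc, mulVec, EuclideanSpace.inner_eq_star_dotProduct, dotProduct_comm]
  refine ⟨G, ?_, fun x => funext fun α => ?_⟩
  · refine mul_eq_one_comm.1 ?_
    ext p q
    have := orthonormal_iff_ite.1 hb.orthonormal (e.symm p) (e.symm q)
    simp only [EmbeddingLike.apply_eq_iff_eq] at this
    rw [Matrix.one_apply, ← this, Matrix.mul_apply, EuclideanSpace.inner_eq_star_dotProduct]
    simp [G, dotProduct, mul_comm]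
  · have hx : ∑ p, (G.mulVec x (e p)) • b p = WithLp.toLp 2 x := by
      simp only [hGx, ← hc]
      exact c.sum_repr' _
    have := hb.inner_sum_apply (hA.isMorphismFamily hφ) (fun p => G.mulVec x (e p)) α
    rw [hx] at this
    rw [hA.2.2, reMap, bigDSum, Finset.sum_apply]
    simp only [Pi.smul_apply, smul_eq_mul]
    refine Eq.trans ?_ this
    simp [EuclideanSpace.inner_eq_star_dotProduct, dotProduct_comm]

theorem IsQuadraticHM.umbilical_and_domainEquiv {n : ℕ} (hn : 1 ≤ n)
    {φ : (Fin (2 * mfun n) → ℝ) → Fin (n + 1) → ℝ} (hφ : IsQuadraticHM φ) :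
    Umbilical φ ∧ ∃ lam : ℝ, 0 < lam ∧ ∃ φ₀ : (Fin (2 * mfun n) → ℝ) → Fin (n + 1) → ℝ,
      MemH21 φ₀ ∧ DomainEquiv φ fun x => lam • φ₀ x := by
  obtain ⟨⟨A, hA⟩, hφ⟩ := hφ
  obtain ⟨U, hUd, lam, hlam, hU⟩ := hA.exists_submodule hn hφ
  obtain rfl := Submodule.eq_top_of_finrank_eq (hUd.trans (by simp))
  have hsq' : ∀ α x, (A α).mulVec ((A α).mulVec x) = lam ^ 2 • x := fun α x => by
    simpa using congrArg WithLp.ofLp (hU α (WithLp.toLp 2 x) trivial)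
  have hsq : ∀ α, A α * A α = lam ^ 2 • (1 : Matrix _ _ ℝ) := fun α =>
    Matrix.ext_of_mulVec_single fun i => by
      rw [← mulVec_mulVec, hsq', smul_mulVec, one_mulVec]
  have hP : IsCliffordSystem fun α => lam⁻¹ • A α := by
    refine isCliffordSystem_of (fun α => ?_) (fun α => ?_) fun α β hαβ => ?_
    · rw [Matrix.IsSymm, transpose_smul, (hA.1 α).eq]
    · rw [smul_mul_smul_comm, hsq, smul_smul]
      rw [show lam⁻¹ * lam⁻¹ * lam ^ 2 = 1 by field_simp, one_smul]
    · rw [smul_mul_smul_comm, smul_mul_smul_comm, (hA.relations hφ).2 α β hαβ, smul_neg]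
  have heig : ∀ α μ, 0 < μ → HasEigen (A α) μ → μ = lam := by
    rintro α μ hμ ⟨v, hv, hAv⟩
    have := hsq' α v
    rw [hAv, mulVec_smul, hAv, smul_smul, ← pow_two] at this
    exact (pow_left_inj₀ hμ.le hlam.le two_ne_zero).1 (smul_left_injective ℝ hv this)
  refine ⟨⟨A, hA, fun α μ ν hμ hν h h' => (heig α μ hμ h).trans (heig α ν hν h').symm⟩,
    lam, hlam, cliffordMap fun α => lam⁻¹ • A α,
    hP.memH21 (Nat.mul_pos two_pos (mfun_pos n)) hn, 1, by simp [IsOrthoMat], fun x => ?_⟩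
  funext α
  simp only [hA.2.2, one_mulVec, Pi.smul_apply, cliffordMap, smul_mulVec, dotProduct_smul]
  rw [smul_inv_smul₀ hlam.ne']

/-- Q-nonsingular quadratic harmonic morphisms `ℝ^M → ℝ^{n+1}` exist
iff `M = 2km(n)` for some `k ≥ 1`; for `k = 1` every such morphism is
domain-minimal (hence umbilical) and domain-equivalent to `λφ₀` with
`φ₀ ∈ H₂¹(2m(n),n+1)`; for `k ≥ 2` it is domain-equivalent to
`λ₁φ₁ ⊕ … ⊕ λₖφₖ` with `λᵢ > 0` and domain-minimal `φᵢ ∈ H₂¹(2m(n),n+1)`. -/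
theorem qnonsingular_qhm_existence_and_classification (n : ℕ) (hn : 1 ≤ n) :
    (∀ M : ℕ,
        (∃ φ : (Fin M → ℝ) → Fin (n + 1) → ℝ, IsQuadraticHM φ ∧ QNonsingular φ) ↔
          ∃ k : ℕ, 0 < k ∧ M = 2 * k * mfun n) ∧
    (∀ φ : (Fin (2 * mfun n) → ℝ) → Fin (n + 1) → ℝ,
        IsQuadraticHM φ → QNonsingular φ →
        DomainMinimal φ ∧ Umbilical φ ∧
          ∃ lam : ℝ, 0 < lam ∧
            ∃ φ₀ : (Fin (2 * mfun n) → ℝ) → Fin (n + 1) → ℝ,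
              MemH21 φ₀ ∧ DomainEquiv φ fun x => lam • φ₀ x) ∧
    (∀ k : ℕ, 2 ≤ k →
        ∀ φ : (Fin (2 * k * mfun n) → ℝ) → Fin (n + 1) → ℝ,
          IsQuadraticHM φ → QNonsingular φ →
          ∃ lam : Fin k → ℝ, (∀ j, 0 < lam j) ∧
            ∃ ψ : Fin k → (Fin (2 * mfun n) → ℝ) → Fin (n + 1) → ℝ,
              (∀ j, MemH21 (ψ j) ∧ DomainMinimal (ψ j)) ∧
                DomainEquiv φ
                  (reMap (show 2 * k * mfun n = k * (2 * mfun n) by ring)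
                    (bigDSum fun j x => lam j • ψ j x))) := by

  have hd : 0 < 2 * mfun n := Nat.mul_pos two_pos (mfun_pos n)
  refine ⟨fun M => ⟨fun ⟨φ, hφ, hQ⟩ => hQ.exists_eq hn hφ, ?_⟩, fun φ hφ _ =>
    ⟨hφ.domainMinimal hn, hφ.umbilical_and_domainEquiv hn⟩, fun k _ φ hφ hQ => ?_⟩
  · rintro ⟨k, hk, rfl⟩
    obtain ⟨P, hP⟩ := exists_isCliffordSystem (k := k) hn
    have hN : 0 < 2 * k * mfun n := Nat.mul_pos (Nat.mul_pos two_pos hk) (mfun_pos n)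
    exact ⟨cliffordMap P, hP.isQuadraticHM hN hn, hP.qNonsingular hN⟩
  · obtain ⟨A, hA, hAb⟩ := hQ.exists_isBlockFamily hn hφ
    obtain ⟨lam, b, hb⟩ := hAb k (by
      rw [show k * (2 * mfun n) = 2 * k * mfun n by ring]
      omega)
    have hP := hb.isCliffordSystem (hA.isMorphismFamily hφ.2)
    exact ⟨lam, hb.pos, fun j => cliffordMap (blockMatrix _ lam b j),
      fun j => ⟨(hP j).memH21 hd hn, ((hP j).isQuadraticHM hd hn).domainMinimal hn⟩,
      hb.domainEquiv _ hA hφ.2⟩
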